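/- arXiv:2307.10510 — 3 statements merged into one kernel-verified Lean document; each statement's English description precedes it below -/
import Mathlib

section
/- Let G be a graph and v ∈ V(G) a vertex of degree 1 whose unique neighbor has degree at most 2 in G. Then G is (P_3, P_4)-good if and only if the graph G − v obtained by deleting v is (P_3, P_4)-good. -/
/-- `G` contains a path on `n` vertices (as a subgraph). -/
def HasNPath {V : Type*} (G : SimpleGraph V) (n : ℕ) : Prop :=
  ∃ (u w : V) (p : G.Walk u w), p.IsPath ∧ p.length + 1 = n

/-- `v` is an endpoint of a path on `n` vertices in `G`. -/
def IsPathEndpoint {V : Type*} (G : SimpleGraph V) (v : V) (n : ℕ) : Prop :=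
  ∃ (w : V) (p : G.Walk v w), p.IsPath ∧ p.length + 1 = n

/-- `x` is the maximum number of vertices of a path in `G` having `v` as an endpoint;
we then say `v` is a strict endpoint of a `P_x` in `G`. -/
def StrictEndpoint {V : Type*} (G : SimpleGraph V) (v : V) (x : ℕ) : Prop :=
  IsPathEndpoint G v x ∧ ∀ y, IsPathEndpoint G v y → y ≤ x

/-- A red/blue coloring of the edges of `G` is given by its red subgraph `R ≤ G`;
the blue subgraph is `G \ R`.  The coloring is `(P_k, P_ℓ)`-good if the red subgraph
has no path on `k` vertices and the blue subgraph has no path on `ℓ` vertices. -/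
def GoodColoring {V : Type*} (G R : SimpleGraph V) (k ℓ : ℕ) : Prop :=
  R ≤ G ∧ ¬ HasNPath R k ∧ ¬ HasNPath (G \ R) ℓ

/-- `G` is `(P_k, P_ℓ)`-good if it admits at least one `(P_k, P_ℓ)`-good coloring. -/
def IsGood {V : Type*} (G : SimpleGraph V) (k ℓ : ℕ) : Prop :=
  ∃ R : SimpleGraph V, GoodColoring G R k ℓ

theorem hasNPath_three_iff {V : Type*} {G : SimpleGraph V} :
    HasNPath G 3 ↔ ∃ a b c, G.Adj a b ∧ G.Adj b c ∧ a ≠ c := by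
  constructor
  · rintro ⟨a, _, p, hp, hl⟩
    match p with
    | .cons (v := b) h (.cons (v := c) h' .nil) =>
      refine ⟨a, b, c, h, h', ?_⟩
      simp at hp
      tauto
    | .nil | .cons _ .nil | .cons _ (.cons _ (.cons _ _)) => simp at hl
  · rintro ⟨a, b, c, h, h', hac⟩
    refine ⟨a, c, .cons h (.cons h' .nil), ?_, rfl⟩
    simp [h.ne, h'.ne, hac]

theorem hasNPath_four_iff {V : Type*} {G : SimpleGraph V} :
    HasNPath G 4 ↔
      ∃ a b c d, G.Adj a b ∧ G.Adj b c ∧ G.Adj c d ∧ a ≠ c ∧ b ≠ d ∧ a ≠ d := by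
  constructor
  · rintro ⟨a, _, p, hp, hl⟩
    match p with
    | .cons (v := b) h (.cons (v := c) h' (.cons (v := d) h'' .nil)) =>
      refine ⟨a, b, c, d, h, h', h'', ?_⟩
      simp at hp
      tauto
    | .nil | .cons _ .nil | .cons _ (.cons _ .nil)
    | .cons _ (.cons _ (.cons _ (.cons _ _))) => simp at hl
  · rintro ⟨a, b, c, d, h, h', h'', hac, hbd, had⟩
    refine ⟨a, d, .cons h (.cons h' (.cons h'' .nil)), ?_, rfl⟩
    simp [h.ne, h'.ne, h''.ne, hac, hbd, had]

theorem HasNPath.map {V W : Type*} {G : SimpleGraph V} {H : SimpleGraph W} {n : ℕ}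
    (f : G →g H) (hf : Function.Injective f) : HasNPath G n → HasNPath H n :=
  fun ⟨_, _, p, hp, hl⟩ ↦ ⟨_, _, p.map f, hp.map hf, by simpa using hl⟩

theorem IsGood.induce {V : Type*} {G : SimpleGraph V} {k l : ℕ} (s : Set V) :
    IsGood G k l → IsGood (G.induce s) k l := by
  rintro ⟨R, hR, hred, hblue⟩
  refine ⟨R.induce s, fun _ _ h ↦ hR h, fun h ↦ hred ?_, fun h ↦ hblue ?_⟩
  · exact h.map ⟨Subtype.val, fun h ↦ h⟩ Subtype.val_injective
  · exact h.map ⟨Subtype.val, fun h ↦ h⟩ Subtype.val_injective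

/-- A `(P_3, P_4)`-good coloring of `G - v` extends to `G`: give the edge `vu` the color
not used by the other edge at `u`. -/
theorem isGood_three_four_of_induce_ne {V : Type*} {G : SimpleGraph V} {v u : V}
    (hu : ∀ w, G.Adj v w ↔ w = u)
    (hnb : ∀ a b, G.Adj u a → G.Adj u b → a ≠ v → b ≠ v → a = b)
    (h : IsGood (G.induce {u | u ≠ v}) 3 4) : IsGood G 3 4 := by
  obtain ⟨R, hR, hred, hblue⟩ := h
  rw [hasNPath_three_iff] at hred
  rw [hasNPath_four_iff] at hblue
  let S := R.map (Function.Embedding.subtype _)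
  have hS : ∀ a b, S.Adj a b ↔ ∃ (ha : a ≠ v) (hb : b ≠ v), R.Adj ⟨a, ha⟩ ⟨b, hb⟩ := by
    intro a b
    simp only [S, SimpleGraph.map_adj]
    constructor
    · rintro ⟨⟨a, ha⟩, ⟨b, hb⟩, h, rfl, rfl⟩
      exact ⟨ha, hb, h⟩
    · rintro ⟨ha, hb, h⟩
      exact ⟨_, _, h, rfl, rfl⟩
  have hSv : ∀ a b, S.Adj a b → a ≠ v ∧ b ≠ v := fun a b h ↦
    let ⟨ha, hb, _⟩ := (hS a b).1 h
    ⟨ha, hb⟩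
  have hSG : ∀ a b, S.Adj a b → G.Adj a b := fun a b h ↦
    let ⟨_, _, h⟩ := (hS a b).1 h
    hR h
  have hSred : ∀ a b c, S.Adj a b → S.Adj b c → a = c := by
    intro a b c h h'
    obtain ⟨ha, hb, h⟩ := (hS a b).1 h
    obtain ⟨_, hc, h'⟩ := (hS b c).1 h'
    by_contra hac
    exact hred ⟨_, _, _, h, h', by simpa using hac⟩
  have hSblue : ∀ a b c d, a ≠ v → b ≠ v → c ≠ v → d ≠ v →
      G.Adj a b → ¬ S.Adj a b → G.Adj b c → ¬ S.Adj b c → G.Adj c d → ¬ S.Adj c d →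
      a ≠ c → b ≠ d → a ≠ d → False := by
    intro a b c d ha hb hc hd h₁ n₁ h₂ n₂ h₃ n₃ hac hbd had
    rw [hS] at n₁ n₂ n₃
    exact hblue ⟨⟨a, ha⟩, ⟨b, hb⟩, ⟨c, hc⟩, ⟨d, hd⟩, ⟨h₁, fun h ↦ n₁ ⟨_, _, h⟩⟩,
      ⟨h₂, fun h ↦ n₂ ⟨_, _, h⟩⟩, ⟨h₃, fun h ↦ n₃ ⟨_, _, h⟩⟩, by simpa using hac,
      by simpa using hbd, by simpa using had⟩
  have hvu : G.Adj v u := (hu u).2 rfl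
  have huv : u ≠ v := hvu.ne'
  clear_value S
  clear hS hred hblue hR
  have hu_of_left : ∀ a b, G.Adj a b → a = v → b = u := fun a b h e ↦ (hu b).1 (e ▸ h)
  have hu_of_right : ∀ a b, G.Adj a b → b = v → a = u := fun a b h e ↦ (hu a).1 (e ▸ h.symm)
  by_cases hw : ∃ w, S.Adj u w
  · obtain ⟨w, hw⟩ := hw
    have hub : ∀ a, G.Adj u a → ¬ S.Adj u a → a = v := fun a ha hn ↦ by
      by_contra hav
      exact hn (hnb a w ha (hSG _ _ hw) hav (hSv _ _ hw).2 ▸ hw)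
    refine ⟨S, fun a b ↦ hSG a b, ?_, ?_⟩
    · rw [hasNPath_three_iff]
      rintro ⟨a, b, c, h, h', hac⟩
      exact hac (hSred _ _ _ h h')
    · rw [hasNPath_four_iff]
      rintro ⟨a, b, c, d, ⟨h₁, n₁⟩, ⟨h₂, n₂⟩, ⟨h₃, n₃⟩, hac, hbd, had⟩
      refine hSblue a b c d ?_ ?_ ?_ ?_ h₁ n₁ h₂ n₂ h₃ n₃ hac hbd had
      · rintro rfl
        obtain rfl := hu_of_left _ _ h₁ rfl
        exact hac (hub _ h₂ n₂).symm
      · rintro rfl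
        exact hac ((hu_of_right _ _ h₁ rfl).trans (hu_of_left _ _ h₂ rfl).symm)
      · rintro rfl
        exact hbd ((hu_of_right _ _ h₂ rfl).trans (hu_of_left _ _ h₃ rfl).symm)
      · rintro rfl
        obtain rfl := hu_of_right _ _ h₃ rfl
        exact hbd (hub _ h₂.symm fun h ↦ n₂ h.symm)
  · push Not at hw
    refine ⟨S ⊔ SimpleGraph.edge v u, ?_, ?_, ?_⟩
    · exact sup_le (fun a b ↦ hSG a b) ((G.edge_le_iff).2 (.inr hvu))
    · rw [hasNPath_three_iff]
      rintro ⟨a, b, c, h, h', hac⟩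
      simp only [SimpleGraph.sup_adj, SimpleGraph.edge_adj] at h h'
      grind [SimpleGraph.adj_comm]
    · rw [hasNPath_four_iff]
      rintro ⟨a, b, c, d, ⟨h₁, n₁⟩, ⟨h₂, n₂⟩, ⟨h₃, n₃⟩, hac, hbd, had⟩
      simp only [SimpleGraph.sup_adj, SimpleGraph.edge_adj] at n₁ n₂ n₃
      refine hSblue a b c d ?_ ?_ ?_ ?_ h₁ (n₁ <| .inl ·) h₂ (n₂ <| .inl ·) h₃ (n₃ <| .inl ·)
        hac hbd had <;> grind

/-- if v has degree 1 and its unique neighbor has degree at most 2,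
then G is (P_3,P_4)-good iff G - v is (P_3,P_4)-good. -/
theorem stmt1 {V : Type*} [Fintype V] [DecidableEq V] (G : SimpleGraph V)
    [DecidableRel G.Adj] (v : V) (hdeg : G.degree v = 1)
    (hnb : ∀ u, G.Adj v u → G.degree u ≤ 2) :
    IsGood G 3 4 ↔ IsGood (G.induce {u | u ≠ v}) 3 4 := by
  refine ⟨IsGood.induce _, ?_⟩
  obtain ⟨u, hu⟩ := Finset.card_eq_one.1 hdeg
  have hu' : ∀ w, G.Adj v w ↔ w = u := fun w ↦ by
    rw [← G.mem_neighborFinset, hu, Finset.mem_singleton]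
  refine isGood_three_four_of_induce_ne hu' fun a b ha hb hav hbv ↦ ?_
  have hvu : G.Adj v u := (hu' u).2 rfl
  by_contra hab
  have hsub : {v, a, b} ⊆ G.neighborFinset u := by
    simp [Finset.insert_subset_iff, hvu.symm, ha, hb]
  have hcard := (Finset.card_le_card hsub).trans (hnb u hvu)
  rw [Finset.card_eq_three.2 ⟨v, a, b, hav.symm, hbv.symm, hab, rfl⟩] at hcard
  omega
end

section
/- For all integers k and ℓ with 3 ≤ k < ℓ, and with ℓ ≥ 5 in case k = 3, there exists a (k, ℓ, k−1)-red-transmitter; that is, a (P_k, P_ℓ)-good graph G with a vertex v such that in every (P_k, P_ℓ)-good coloring of G, v is a strict endpoint of a red P_{k−1} and v is incident to no blue edge. -/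
namespace PathRamsey

variable {V : Type*} {G : SimpleGraph V} {S : Finset V} {l : List V} {c : ℕ}

/-- The list `l` is the vertex sequence of a path of `G` inside `S`. -/
def IsPathIn (G : SimpleGraph V) (S : Finset V) (l : List V) : Prop :=
  l.Nodup ∧ l.IsChain G.Adj ∧ ∀ x ∈ l, x ∈ S

/-- `l` is a longest path of `G` inside `S`. -/
def IsLongestIn (G : SimpleGraph V) (S : Finset V) (l : List V) : Prop :=
  IsPathIn G S l ∧ ∀ l', IsPathIn G S l' → l'.length ≤ l.length

/-- The subgraph of `G` induced on `S` is connected, in terms of cuts. -/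
def ConnectedOn [DecidableEq V] (G : SimpleGraph V) (S : Finset V) : Prop :=
  ∀ A ⊆ S, A.Nonempty → (S \ A).Nonempty → ∃ x ∈ A, ∃ y ∈ S \ A, G.Adj x y

open Classical in
/-- The degree of `x` into `S`. -/
noncomputable def degOn (G : SimpleGraph V) (S : Finset V) (x : V) : ℕ :=
  (S.filter (G.Adj x)).card

lemma IsPathIn.length_le (h : IsPathIn G S l) : l.length ≤ S.card := by
  classical
  rw [← List.toFinset_card_of_nodup h.1]
  exact Finset.card_le_card fun x hx => h.2.2 x (List.mem_toFinset.1 hx)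

lemma IsPathIn.reverse (h : IsPathIn G S l) : IsPathIn G S l.reverse := by
  refine ⟨List.nodup_reverse.2 h.1, ?_, by simpa using h.2.2⟩
  rw [List.isChain_reverse]
  simpa [G.adj_comm] using h.2.1

lemma IsLongestIn.reverse (h : IsLongestIn G S l) : IsLongestIn G S l.reverse :=
  ⟨h.1.reverse, by simpa using h.2⟩

lemma exists_isLongestIn (G : SimpleGraph V) (S : Finset V) : ∃ l, IsLongestIn G S l := by
  by_contra! h
  have : ∀ n, ∃ l, IsPathIn G S l ∧ n ≤ l.length := by
    intro n
    induction n with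
    | zero => exact ⟨[], ⟨by simp, by simp, by simp⟩, by simp⟩
    | succ n ih =>
      obtain ⟨l, hl, hn⟩ := ih
      by_contra! h2
      exact h l ⟨hl, fun l' hl' => by have := h2 l' hl'; omega⟩
  obtain ⟨l, hl, hn⟩ := this (S.card + 1)
  have := hl.length_le
  omega

/-- A longest path missing some vertex of a connected set cannot be closed up to a cycle. -/
lemma IsLongestIn.not_cycle [DecidableEq V] (hl : IsLongestIn G S l) (hS : ConnectedOn G S)
    (hlt : l.length < S.card) {p : List V} (hp : IsPathIn G S p) (hlen : p.length = l.length)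
    (hne : p ≠ []) (hcl : ∀ x ∈ p.getLast?, ∀ y ∈ p.head?, G.Adj x y) : False := by
  have hsub : p.toFinset ⊆ S := fun x hx => hp.2.2 x (List.mem_toFinset.1 hx)
  obtain ⟨x, hx, y, hy, hxy⟩ := hS p.toFinset hsub (by simpa using hne) (by
    rw [← Finset.card_pos, Finset.card_sdiff_of_subset hsub, List.toFinset_card_of_nodup hp.1]
    omega)
  rw [List.mem_toFinset] at hx
  rw [Finset.mem_sdiff, List.mem_toFinset] at hy
  obtain ⟨p₁, p₂, rfl⟩ := List.append_of_mem hx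
  have h := hl.2 (y :: (x :: p₂ ++ p₁)) (by
    refine ⟨?_, ?_, ?_⟩
    · have := hp.1
      grind
    · rw [List.cons_append, List.isChain_cons_cons, ← List.cons_append, List.isChain_append]
      have h2 := hp.2.1
      rw [List.isChain_append] at h2
      refine ⟨hxy.symm, h2.2.1, h2.1, ?_⟩
      intro a ha b hb
      refine hcl a ?_ b ?_
      · simp at ha ⊢; exact ha
      · cases p₁ <;> simp_all
    · have := hp.2.2
      grind)
  simp at h hlen
  omega

lemma IsLongestIn.mem_of_adj_head {u : V} (hl : IsLongestIn G S (u :: l)) {y : V}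
    (hy : y ∈ S) (h : G.Adj u y) : y ∈ l := by
  by_contra hyl
  have := hl.2 (y :: u :: l) (by
    refine ⟨List.nodup_cons.2 ⟨?_, hl.1.1⟩, List.isChain_cons_cons.2 ⟨h.symm, hl.1.2.1⟩, ?_⟩
    · simp [hyl, h.ne']
    · simpa [hy] using hl.1.2.2)
  simp at this

/-- The first vertex of a longest path is not a cut vertex. -/
lemma IsLongestIn.connectedOn_erase [DecidableEq V] {u : V} (hl : IsLongestIn G S (u :: l))
    (hS : ConnectedOn G S) : ConnectedOn G (S.erase u) := by
  intro A hA hA0 hA1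
  by_contra! hcon
  have key : ∀ m : List V, m.IsChain G.Adj → (∀ x ∈ m, x ∈ S.erase u) →
      (∀ x ∈ m, x ∈ A) ∨ (∀ x ∈ m, x ∉ A) := by
    intro m
    induction m with
    | nil => simp
    | cons x m ih =>
      intro hc hm
      have := ih hc.of_cons (fun y hy => hm y (by simp [hy]))
      cases m with
      | nil => simp [em]
      | cons y m =>
        have hxy := (List.isChain_cons_cons.1 hc).1
        have hx := hm x (by simp)
        have hy := hm y (by simp)
        have h1 := hcon x
        have h2 := hcon y
        have h3 := hxy.symm
        grind
  have hnd := hl.1.1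
  have hmem := hl.1.2.2
  obtain h | h := key l hl.1.2.1.of_cons (by grind)
  · obtain ⟨x, hx, y, hy, hxy⟩ := hS (insert u A)
      (Finset.insert_subset (hmem u (by simp)) (hA.trans (Finset.erase_subset _ _)))
      (by simp) (by
        obtain ⟨z, hz⟩ := hA1
        exact ⟨z, by grind⟩)
    have h1 := hcon x
    have h2 : x = u → y ∈ l := by
      rintro rfl
      exact hl.mem_of_adj_head (by grind) hxy
    grind
  · obtain ⟨x, hx, y, hy, hxy⟩ := hS A (hA.trans (Finset.erase_subset _ _)) hA0 (by
        obtain ⟨z, hz⟩ := hA1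
        exact ⟨z, by grind⟩)
    have h1 := hcon x
    have h2 : y = u → x ∈ l := by
      rintro rfl
      exact hl.mem_of_adj_head (by grind) hxy.symm
    grind

lemma IsLongestIn.not_crossing [DecidableEq V] {q r : List V} {a b u w : V}
    (hl : IsLongestIn G S (q ++ a :: b :: r)) (hS : ConnectedOn G S)
    (hlt : (q ++ a :: b :: r).length < S.card) (hu : u ∈ (q ++ a :: b :: r).head?)
    (hw : w ∈ (q ++ a :: b :: r).getLast?) (hub : G.Adj u b) (hwa : G.Adj w a) : False := by
  have hc := hl.1.2.1
  rw [List.isChain_split, List.isChain_cons_cons] at hc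
  refine hl.not_cycle hS hlt (p := (q ++ [a]).reverse ++ b :: r) ⟨?_, ?_, ?_⟩ ?_ ?_ ?_
  · have := hl.1.1
    grind
  · rw [List.isChain_append, List.isChain_reverse]
    refine ⟨by simpa [G.adj_comm] using hc.1, hc.2.2, ?_⟩
    intro x hx y hy
    obtain rfl : b = y := by simpa using hy
    have : x = u := by
      rw [List.getLast?_reverse] at hx
      cases q <;> simp_all
    rwa [this]
  · have := hl.1.2.2
    grind
  · simp
    omega
  · simp
  · intro x hx y hy
    have h1 : y = a := by simp_all
    have h2 : x = w := by
      rw [List.getLast?_append] at hx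
      rw [List.append_cons, List.getLast?_append] at hw
      simp only [List.getLast?_cons, Option.some_or, Option.mem_some_iff] at hx hw
      exact hx.symm.trans hw
    rwa [h1, h2]

/-- If a longest path misses a vertex of a connected set, then the degrees of its ends
have sum less than its number of vertices. -/
lemma IsLongestIn.degOn_add_degOn_lt (hl : IsLongestIn G S l) [DecidableEq V]
    (hS : ConnectedOn G S) (hlt : l.length < S.card) {u w : V}
    (hu : u ∈ l.head?) (hw : w ∈ l.getLast?) : degOn G S u + degOn G S w < l.length := by
  classical
  have hpos : 0 < l.length := by
    cases l <;> simp_all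
  have hu0 : l[0] = u := by
    cases l <;> simp_all
  have hw0 : l[l.length - 1] = w := by
    rw [List.getLast?_eq_getElem?] at hw
    grind
  set I := (Finset.range (l.length - 1)).filter fun i => ∃ h : i + 1 < l.length, G.Adj u l[i + 1]
    with hI
  set J := (Finset.range (l.length - 1)).filter fun i => ∃ h : i < l.length, G.Adj w l[i] with hJ
  have hdu : degOn G S u ≤ I.card := by
    refine (Finset.card_le_card (t := I.image fun i => l.getD (i + 1) u) ?_).trans
      Finset.card_image_le
    intro y hy
    rw [Finset.mem_filter] at hy
    obtain ⟨v, m, rfl⟩ : ∃ v m, l = v :: m := by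
      cases l <;> simp_all
    obtain rfl : v = u := by simpa using hu
    have hym := hl.mem_of_adj_head hy.1 hy.2
    obtain ⟨i, hi, rfl⟩ := List.getElem_of_mem hym
    rw [Finset.mem_image]
    refine ⟨i, ?_, ?_⟩
    · rw [hI, Finset.mem_filter]
      refine ⟨by simpa using hi, by simpa using hi, by simpa using hy.2⟩
    · simp [hi]
  have hdw : degOn G S w ≤ J.card := by
    refine (Finset.card_le_card (t := J.image fun i => l.getD i u) ?_).trans
      Finset.card_image_le
    intro y hy
    rw [Finset.mem_filter] at hy
    have hr := hl.reverse
    obtain ⟨v, m, hm⟩ : ∃ v m, l.reverse = v :: m := by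
      cases h : l.reverse <;> simp_all
    obtain rfl : v = w := by
      rw [← List.head?_reverse, hm] at hw
      simpa using hw
    rw [hm] at hr
    have hym : y ∈ l := by
      have := hr.mem_of_adj_head hy.1 hy.2
      rw [← List.mem_reverse, hm]
      simp [this]
    obtain ⟨i, hi, rfl⟩ := List.getElem_of_mem hym
    rw [Finset.mem_image]
    refine ⟨i, ?_, ?_⟩
    · rw [hJ, Finset.mem_filter]
      refine ⟨?_, hi, hy.2⟩
      rw [Finset.mem_range]
      by_contra hcon
      obtain rfl : i = l.length - 1 := by omega
      rw [hw0] at hy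
      exact hy.2.ne rfl
    · simp [hi]
  have hdisj : Disjoint I J := by
    rw [Finset.disjoint_left]
    intro i hi hj
    rw [hI, Finset.mem_filter] at hi
    rw [hJ, Finset.mem_filter] at hj
    obtain ⟨-, h1, h2⟩ := hi
    obtain ⟨-, h3, h4⟩ := hj
    have hsplit : l = l.take i ++ l[i] :: l[i + 1] :: l.drop (i + 1 + 1) := by
      rw [List.getElem_cons_drop, List.getElem_cons_drop, List.take_append_drop]
    rw [hsplit] at hl hlt hu hw
    exact hl.not_crossing hS hlt hu hw h2 h4
  have := Finset.card_le_card (s := I ∪ J) (t := Finset.range (l.length - 1)) (by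
    rw [hI, hJ]
    exact Finset.union_subset (Finset.filter_subset _ _) (Finset.filter_subset _ _))
  rw [Finset.card_union_of_disjoint hdisj, Finset.card_range] at this
  omega

lemma degOn_mono (G : SimpleGraph V) {A : Finset V} (h : A ⊆ S) (x : V) :
    degOn G A x ≤ degOn G S x := by
  classical
  exact Finset.card_le_card (Finset.filter_subset_filter _ h)

lemma degOn_lt_card (G : SimpleGraph V) {x : V} (hx : x ∈ S) : degOn G S x < S.card := by
  classical
  exact Finset.card_lt_card (Finset.filter_ssubset.2 ⟨x, hx, G.irrefl⟩)

lemma adj_of_degOn_eq {x y : V} (hx : x ∈ S) (hy : y ∈ S) (hxy : x ≠ y)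
    (h : degOn G S x + 1 = S.card) : G.Adj x y := by
  classical
  have hsub : S.filter (G.Adj x) ⊆ S.erase x := fun z hz => by
    rw [Finset.mem_filter] at hz
    exact Finset.mem_erase.2 ⟨hz.2.ne', hz.1⟩
  have heq := Finset.eq_of_subset_of_card_le hsub (by
    rw [Finset.card_erase_of_mem hx, ← h]
    simp [degOn])
  have : y ∈ S.filter (G.Adj x) := heq ▸ Finset.mem_erase.2 ⟨hxy.symm, hy⟩
  exact (Finset.mem_filter.1 this).2

/-- The sum of the degrees in the subgraph induced on `S`. -/
noncomputable def degSum (G : SimpleGraph V) (S : Finset V) : ℕ :=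
  ∑ x ∈ S, degOn G S x

lemma degSum_erase [DecidableEq V] (G : SimpleGraph V) {u : V} (hu : u ∈ S) :
    degSum G S = degSum G (S.erase u) + 2 * degOn G S u := by
  classical
  have h1 : ∀ x, degOn G S x = degOn G (S.erase u) x + if G.Adj u x then 1 else 0 := by
    intro x
    unfold degOn
    rw [Finset.filter_erase]
    split_ifs with h
    · rw [Finset.card_erase_add_one (Finset.mem_filter.2 ⟨hu, h.symm⟩)]
    · rw [Finset.erase_eq_of_notMem (by simp [hu, G.adj_comm x u, h])]
      rfl
  have h2 : ∑ x ∈ S.erase u, (if G.Adj u x then 1 else 0) = degOn G S u := by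
    rw [← Finset.card_filter, h1 u]
    simp [degOn]
  unfold degSum
  rw [← Finset.sum_erase_add _ _ hu, Finset.sum_congr rfl fun x _ => h1 x,
    Finset.sum_add_distrib, h2]
  ring

lemma degSum_le (G : SimpleGraph V) (S : Finset V) : degSum G S + S.card ≤ S.card * S.card := by
  have : ∑ x ∈ S, (degOn G S x + 1) ≤ ∑ x ∈ S, S.card :=
    Finset.sum_le_sum fun x hx => degOn_lt_card G hx
  simpa [Finset.sum_add_distrib, degSum] using this

lemma degOn_eq_of_degSum_eq (h : degSum G S + S.card = S.card * S.card) {x : V} (hx : x ∈ S) :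
    degOn G S x + 1 = S.card := by
  have h1 : ∑ x ∈ S, (degOn G S x + 1) = ∑ x ∈ S, S.card := by
    simpa [Finset.sum_add_distrib, degSum] using h
  exact (Finset.sum_eq_sum_iff_of_le fun x hx => degOn_lt_card G hx).1 h1 x hx

/-- A connected graph without a path on `c + 2` vertices but with at least `c + 2` vertices
has fewer edges than the disjoint union of complete graphs on `c + 1` vertices. -/
lemma degSum_add_le_of_connectedOn [DecidableEq V] (hc : 1 ≤ c) (hS : ConnectedOn G S)
    (hcard : c + 2 ≤ S.card) (hG : ∀ l, IsPathIn G S l → l.length ≤ c + 1) :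
    degSum G S + c ≤ c * S.card ∧ (3 ≤ c → degSum G S + c < c * S.card) := by
  induction hn : S.card using Nat.strong_induction_on generalizing S with
  | _ n ih =>
  subst hn
  obtain ⟨l, hl⟩ := exists_isLongestIn G S
  have hlc := hG l hl.1
  have hlt : l.length < S.card := by omega
  obtain ⟨x₀, hx₀⟩ : S.Nonempty := Finset.card_pos.1 (by omega)
  have hlne : l ≠ [] := by
    rintro rfl
    have := hl.2 [x₀] ⟨by simp, by simp, by simpa using hx₀⟩
    simp at this
  obtain ⟨u, hu⟩ : ∃ u, u ∈ l.head? := ⟨l.head hlne, List.head_mem_head? hlne⟩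
  obtain ⟨w, hw⟩ : ∃ w, w ∈ l.getLast? := ⟨l.getLast hlne, List.getLast_mem_getLast? hlne⟩
  have hdeg := hl.degOn_add_degOn_lt hS hlt hu hw
  have huS : u ∈ S := hl.1.2.2 u (List.mem_of_mem_head? hu)
  have hwS : w ∈ S := hl.1.2.2 w (List.mem_of_mem_getLast? hw)
  obtain hcard | hcard := hcard.lt_or_eq
  · have step : ∀ (l : List V) (u : V), IsLongestIn G S l → u ∈ l.head? → u ∈ S →
        2 * degOn G S u ≤ c →
        degSum G S + c ≤ c * S.card ∧ (3 ≤ c → degSum G S + c < c * S.card) := by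
      intro l u hl hu huS hd
      obtain ⟨v, m, rfl⟩ : ∃ v m, l = v :: m := by
        cases l <;> simp_all
      obtain rfl : v = u := by simpa using hu
      have he := Finset.card_erase_add_one huS
      have := ih (S.erase v).card (by omega) (hl.connectedOn_erase hS) (by omega)
        (fun l' hl' => hG l' ⟨hl'.1, hl'.2.1, fun x hx => Finset.mem_of_mem_erase (hl'.2.2 x hx)⟩)
        rfl
      rw [degSum_erase G huS, ← he, mul_add]
      omega
    obtain h | h : 2 * degOn G S u ≤ c ∨ 2 * degOn G S w ≤ c := by omega
    · exact step l u hl hu huS h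
    · exact step l.reverse w hl.reverse (by simpa using hw) hwS h
  · have huw : u ≠ w := by
      rintro rfl
      obtain ⟨v, m, rfl⟩ : ∃ v m, l = v :: m := by
        cases l <;> simp_all
      obtain rfl : v = u := by simpa using hu
      have hm : m = [] := by
        by_contra hm
        have := hl.1.1
        rw [List.nodup_cons] at this
        refine this.1 (List.mem_of_mem_getLast? (l := m) ?_)
        rwa [List.getLast?_cons_of_ne_nil hm] at hw
      subst hm
      obtain ⟨x, hx, y, hy, hxy⟩ := hS {v} (by simpa using huS) (by simp) (by
        rw [← Finset.card_pos, Finset.card_sdiff_of_subset (by simpa using huS)]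
        simp
        omega)
      obtain rfl : x = v := by simpa using hx
      simpa using hl.mem_of_adj_head (Finset.mem_sdiff.1 hy).1 hxy
    have hwu : w ∈ S.erase u := Finset.mem_erase.2 ⟨huw.symm, hwS⟩
    have h1 := degSum_erase G huS
    have h2 := degSum_erase G hwu
    have h3 := degOn_mono G (Finset.erase_subset u S) w
    have h4 := degSum_le G ((S.erase u).erase w)
    have hcT : ((S.erase u).erase w).card = c := by
      rw [Finset.card_erase_of_mem hwu, Finset.card_erase_of_mem huS]
      omega
    rw [hcT] at h4
    have h5 : c * S.card = c * c + 2 * c := by rw [← hcard]; ring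
    refine ⟨by omega, fun hc3 => ?_⟩
    by_contra hcon
    have h6 : l.length = c + 1 := by omega
    have h7 : degSum G ((S.erase u).erase w) + c = c * c := by omega
    have hcomp : ∀ x ∈ S, x ≠ u → x ≠ w → ∀ y ∈ S, y ≠ u → y ≠ w → x ≠ y → G.Adj x y := by
      intro x hx hxu hxw y hy hyu hyw hxy
      refine adj_of_degOn_eq (S := (S.erase u).erase w) (by simp [*]) (by simp [*]) hxy ?_
      exact degOn_eq_of_degSum_eq (by rw [hcT]; exact h7) (by simp [*])
    obtain ⟨y, hy, hyl⟩ : ∃ y ∈ S, y ∉ l := by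
      by_contra! hall
      have := Finset.card_le_card (s := S) (t := l.toFinset) (fun x hx => by simpa using hall x hx)
      have := l.toFinset_card_le
      omega
    obtain ⟨v₁, v₂, v₃, v₄, m, rfl⟩ : ∃ v₁ v₂ v₃ v₄ m, l = v₁ :: v₂ :: v₃ :: v₄ :: m := by
      match l, h6 with
      | v₁ :: v₂ :: v₃ :: v₄ :: m, _ => exact ⟨_, _, _, _, _, rfl⟩
      | [], h | [_], h | [_, _], h | [_, _, _], h =>
        simp only [List.length_nil, List.length_cons] at h
        omega
    obtain rfl : v₁ = u := by simpa using hu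
    have hw' : w ∈ v₄ :: m := by
      refine List.mem_of_mem_getLast? ?_
      simpa [List.getLast?_cons_cons] using hw
    have hnd := hl.1.1
    have hmem := hl.1.2.2
    have hch := hl.1.2.1
    have h8 : G.Adj v₂ y := hcomp _ (by grind) (by grind) (by grind) _ hy (by grind) (by grind)
      (by grind)
    have h9 : G.Adj y v₃ := hcomp _ hy (by grind) (by grind) _ (by grind) (by grind) (by grind)
      (by grind)
    have := hl.2 (v₁ :: v₂ :: y :: v₃ :: v₄ :: m) ⟨by grind, by
      simp only [List.isChain_cons_cons] at hch ⊢
      exact ⟨hch.1, h8, h9, hch.2.2⟩, by grind⟩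
    simp at this

/-- The Erdős–Gallai bound for a graph without a path on `c + 2` vertices, with its stability:
if the number of vertices is not a multiple of `c + 1`, the degree sum drops by at least `c`. -/
lemma degSum_stability [DecidableEq V] (hc : 1 ≤ c) (S : Finset V)
    (hG : ∀ l, IsPathIn G S l → l.length ≤ c + 1) :
    degSum G S ≤ c * S.card ∧ (degSum G S = c * S.card → ∀ x ∈ S, degOn G S x = c) ∧
    (¬ c + 1 ∣ S.card → degSum G S + c ≤ c * S.card) ∧
    (3 ≤ c → S.card % (c + 1) = 1 → degSum G S + c = c * S.card →
      ∃ w ∈ S, degOn G S w = 0 ∧ ∀ x ∈ S, x ≠ w → degOn G S x = c) := by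
  induction hn : S.card using Nat.strong_induction_on generalizing S with
  | _ n ih =>
  subst hn
  by_cases hS : ConnectedOn G S
  · obtain hcard | hcard := le_or_gt (c + 2) S.card
    · obtain ⟨h1, h2⟩ := degSum_add_le_of_connectedOn hc hS hcard hG
      exact ⟨by omega, by omega, fun _ => h1, fun h3 _ h4 => absurd h4 (h2 h3).ne⟩
    have hle := degSum_le G S
    obtain h0 | h0 := Nat.eq_zero_or_pos S.card
    · obtain rfl := Finset.card_eq_zero.1 h0
      simp [degSum]
    obtain h1 | h1 : S.card = c + 1 ∨ S.card ≤ c := by omega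
    · have hmul : S.card * S.card = c * S.card + S.card := by rw [h1]; ring
      refine ⟨by omega, fun heq x hx => ?_, fun h => absurd (by rw [h1]) h, fun h3 h4 => ?_⟩
      · have := degOn_eq_of_degSum_eq (G := G) (S := S) (by omega) hx
        omega
      · rw [h1, Nat.mod_self] at h4
        omega
    · have h2 : degSum G S + c ≤ c * S.card := by nlinarith
      refine ⟨by omega, by omega, fun _ => h2, fun h3 h4 h5 => ?_⟩
      rw [Nat.mod_eq_of_lt (by omega)] at h4
      obtain ⟨w, rfl⟩ := Finset.card_eq_one.1 h4
      refine ⟨w, by simp, ?_, by simp⟩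
      have := degOn_lt_card G (Finset.mem_singleton_self w)
      simpa using this
  · unfold ConnectedOn at hS
    push Not at hS
    obtain ⟨A, hAS, hA, hB, hno⟩ := hS
    set B := S \ A with hBdef
    have hdisj : Disjoint A B := Finset.disjoint_sdiff
    have hunion : A ∪ B = S := Finset.union_sdiff_of_subset hAS
    have hcard : A.card + B.card = S.card := by
      rw [← hunion, Finset.card_union_of_disjoint hdisj]
    have hdA : ∀ x ∈ A, degOn G S x = degOn G A x := by
      intro x hx
      unfold degOn
      congr 1
      ext y
      simp only [Finset.mem_filter]
      have := hno x hx y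
      grind
    have hdB : ∀ x ∈ B, degOn G S x = degOn G B x := by
      intro x hx
      unfold degOn
      congr 1
      ext y
      simp only [Finset.mem_filter]
      have := fun hy => hno y hy x hx
      have := G.adj_comm x y
      grind
    have hsum : degSum G S = degSum G A + degSum G B := by
      unfold degSum
      rw [← Finset.sum_congr rfl hdA, ← Finset.sum_congr rfl hdB,
        ← Finset.sum_union hdisj, hunion]
    have hmul : c * S.card = c * A.card + c * B.card := by rw [← hcard]; ring
    have hA' := hA.card_pos
    have hB' := hB.card_pos
    have key : ∀ D ⊆ S, D.card < S.card → _ := fun D hD hlt =>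
      ih D.card hlt D (fun l hl => hG l ⟨hl.1, hl.2.1, fun x hx => hD (hl.2.2 x hx)⟩) rfl
    have hSmem : ∀ x ∈ S, x ∈ A ∨ x ∈ B := fun x hx => by
      rw [← hunion] at hx
      simpa using hx
    have hBS : B ⊆ S := Finset.sdiff_subset
    obtain ⟨a1, a2, a3, a4⟩ := key A hAS (by omega)
    obtain ⟨b1, b2, b3, b4⟩ := key B hBS (by omega)
    refine ⟨by omega, fun h x hx => ?_, fun h => ?_, fun h3 h4 h5 => ?_⟩
    · obtain hx | hx := hSmem x hx
      · rw [hdA x hx, a2 (by omega) x hx]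
      · rw [hdB x hx, b2 (by omega) x hx]
    · by_cases hdiv : c + 1 ∣ A.card
      · have := b3 fun hB => h (by rw [← hcard]; exact dvd_add hdiv hB)
        omega
      · have := a3 hdiv
        omega
    · by_cases hdiv : c + 1 ∣ A.card
      · have hmod : B.card % (c + 1) = 1 := by
          rwa [← hcard, Nat.add_mod, Nat.mod_eq_zero_of_dvd hdiv, zero_add, Nat.mod_mod] at h4
        have := b3 fun hB => by rw [Nat.mod_eq_zero_of_dvd hB] at hmod; omega
        obtain ⟨w, hw, hw0, hw1⟩ := b4 h3 hmod (by omega)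
        have := a2 (by omega)
        exact ⟨w, hBS hw, by rw [hdB w hw, hw0], by grind⟩
      · have := a3 hdiv
        have hdivB : c + 1 ∣ B.card := by
          by_contra hB
          have := b3 hB
          omega
        have hmod : A.card % (c + 1) = 1 := by
          rwa [← hcard, Nat.add_mod, Nat.mod_eq_zero_of_dvd hdivB, add_zero, Nat.mod_mod] at h4
        obtain ⟨w, hw, hw0, hw1⟩ := a4 h3 hmod (by omega)
        have := b2 (by omega)
        exact ⟨w, hAS hw, by rw [hdA w hw, hw0], by grind⟩

lemma length_le_of_not_hasNPath (h : ¬ HasNPath G (c + 2)) (hl : IsPathIn G S l) :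
    l.length ≤ c + 1 := by
  by_contra! hlt
  have hlen : (l.take (c + 2)).length = c + 2 := by
    rw [List.length_take]
    omega
  have hne : l.take (c + 2) ≠ [] := by
    rw [← List.length_pos_iff]
    omega
  refine h ⟨_, _, SimpleGraph.Walk.ofSupport _ hne (hl.2.1.take _), ?_, ?_⟩
  · rw [SimpleGraph.Walk.isPath_def, SimpleGraph.Walk.support_ofSupport]
    exact hl.1.sublist (List.take_sublist _ _)
  · rw [SimpleGraph.Walk.length_ofSupport]
    omega

lemma isPathEndpoint_iff {v : V} {n : ℕ} :
    IsPathEndpoint G v (n + 1) ↔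
      ∃ l : List V, (v :: l).Nodup ∧ (v :: l).IsChain G.Adj ∧ l.length = n := by
  constructor
  · rintro ⟨w, p, hp, hn⟩
    refine ⟨p.support.tail, ?_, ?_, ?_⟩
    · rw [p.cons_tail_support]
      exact hp.support_nodup
    · rw [p.cons_tail_support]
      exact p.isChain_adj_support
    · rw [List.length_tail, p.length_support]
      omega
  · rintro ⟨l, h1, h2, h3⟩
    have hne : v :: l ≠ [] := by simp
    change IsPathEndpoint G ((v :: l).head hne) (n + 1)
    refine ⟨_, SimpleGraph.Walk.ofSupport (v :: l) hne h2, ?_, ?_⟩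
    · rw [SimpleGraph.Walk.isPath_def, SimpleGraph.Walk.support_ofSupport]
      exact h1
    · rw [SimpleGraph.Walk.length_ofSupport]
      simpa using h3

lemma degOn_lt_of_nodup [Fintype V] [DecidableEq V] {u : V} (hu : u ∈ l)
    (h : ∀ y, G.Adj u y → y ∈ l) : degOn G Finset.univ u < l.length := by
  classical
  have hsub : Finset.univ.filter (G.Adj u) ⊆ l.toFinset.erase u := fun y hy => by
    rw [Finset.mem_filter] at hy
    exact Finset.mem_erase.2 ⟨hy.2.ne', List.mem_toFinset.2 (h y hy.2)⟩
  have h1 := Finset.card_le_card hsub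
  have h2 := Finset.card_erase_lt_of_mem (List.mem_toFinset.2 hu)
  have h3 := l.toFinset_card_le
  unfold degOn
  omega

lemma degOn_pos [Fintype V] {u w : V} (h : G.Adj u w) : 0 < degOn G Finset.univ u := by
  classical
  exact Finset.card_pos.2 ⟨w, by simpa using h⟩

/-- If every non-isolated vertex has degree at least `c`, then paths from a vertex of degree at
least `c` can be built greedily up to `c + 1` vertices. -/
lemma isPathEndpoint_of_le_degOn [Fintype V] {v : V} (hv : c ≤ degOn G Finset.univ v)
    (h : ∀ x, 0 < degOn G Finset.univ x → c ≤ degOn G Finset.univ x) :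
    IsPathEndpoint G v (c + 1) := by
  classical
  have key : ∀ j ≤ c, ∃ p : List V, (p ++ [v]).Nodup ∧ (p ++ [v]).IsChain G.Adj ∧
      p.length = j := by
    intro j hj
    induction j with
    | zero => exact ⟨[], by simp, by simp, rfl⟩
    | succ j ih =>
      obtain ⟨p, h1, h2, h3⟩ := ih (by omega)
      obtain ⟨u, q, hq, hu⟩ : ∃ u q, p ++ [v] = u :: q ∧ c ≤ degOn G Finset.univ u := by
        match p, h2 with
        | [], _ => exact ⟨v, [], rfl, hv⟩
        | [u], h2 =>
          simp only [List.cons_append, List.nil_append, List.isChain_cons_cons] at h2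
          exact ⟨u, [v], rfl, h u (degOn_pos h2.1)⟩
        | u :: w :: p, h2 =>
          simp only [List.cons_append, List.isChain_cons_cons] at h2
          exact ⟨u, w :: p ++ [v], rfl, h u (degOn_pos h2.1)⟩
      obtain ⟨y, hy, hyl⟩ : ∃ y, G.Adj u y ∧ y ∉ p ++ [v] := by
        by_contra! hall
        have := degOn_lt_of_nodup (by simp [hq]) hall
        simp only [List.length_append, List.length_singleton] at this
        omega
      refine ⟨y :: p, List.nodup_cons.2 ⟨hyl, h1⟩, ?_, by simp [h3]⟩
      rw [List.cons_append, hq, List.isChain_cons_cons]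
      exact ⟨hy.symm, hq ▸ h2⟩
  obtain ⟨p, h1, h2, h3⟩ := key c le_rfl
  refine isPathEndpoint_iff.2 ⟨p.reverse, ?_, ?_, by simpa using h3⟩
  · simpa using List.nodup_reverse.2 h1
  · have : (p ++ [v]).reverse.IsChain G.Adj := by
      rw [List.isChain_reverse]
      simpa [G.adj_comm] using h2
    simpa using this

lemma strictEndpoint_of_not_hasNPath {v : V} (h : ¬ HasNPath G (c + 2))
    (hv : IsPathEndpoint G v (c + 1)) : StrictEndpoint G v (c + 1) := by
  classical
  refine ⟨hv, fun y hy => ?_⟩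
  obtain _ | n := y
  · omega
  obtain ⟨l, h1, h2, h3⟩ := isPathEndpoint_iff.1 hy
  have := length_le_of_not_hasNPath h (S := (v :: l).toFinset) ⟨h1, h2, by simp⟩
  simpa [h3] using this

/-- The disjoint union of the complete graphs on the fibres of `f`. -/
def fibreGraph {ι : Type*} (f : V → ι) : SimpleGraph V where
  Adj x y := x ≠ y ∧ f x = f y
  symm := ⟨fun _ _ h => ⟨h.1.symm, h.2.symm⟩⟩
  loopless := ⟨fun _ h => h.1 rfl⟩

lemma fibreGraph_sup_sdiff {ι κ : Type*} {f : V → ι} {g : V → κ}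
    (hfg : ∀ x y, f x = f y → g x = g y → x = y) :
    (fibreGraph f ⊔ fibreGraph g) \ fibreGraph f = fibreGraph g := by
  ext x y
  have := hfg x y
  simp only [SimpleGraph.sdiff_adj, SimpleGraph.sup_adj, fibreGraph]
  tauto

section

variable [Fintype V] {ι κ : Type*} [DecidableEq ι] [DecidableEq κ]

lemma degOn_fibreGraph (f : V → ι) (x : V) :
    degOn (fibreGraph f) Finset.univ x + 1 = (Finset.univ.filter fun y => f y = f x).card := by
  classical
  rw [← Finset.card_erase_add_one (s := Finset.univ.filter fun y => f y = f x) (a := x) (by simp)]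
  unfold degOn
  congr 2
  ext y
  simp [fibreGraph, eq_comm (a := x), eq_comm (a := f x)]

lemma not_hasNPath_fibreGraph {f : V → ι}
    (hf : ∀ x, (Finset.univ.filter fun y => f y = f x).card ≤ c + 1) :
    ¬ HasNPath (fibreGraph f) (c + 2) := by
  classical
  rintro ⟨u, w, p, hp, hlen⟩
  have hsupp : ∀ y ∈ p.support, f y = f u := by
    clear hp hlen
    induction p with
    | nil => simp
    | cons h p ih =>
      intro y hy
      obtain rfl | hy := List.mem_cons.1 (by simpa using hy)
      · rfl
      · exact (ih y hy).trans h.2.symm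
  have h1 := List.toFinset_card_of_nodup hp.support_nodup
  have h2 : p.support.toFinset ⊆ Finset.univ.filter fun y => f y = f u := fun y hy => by
    simpa using hsupp y (List.mem_toFinset.1 hy)
  have h3 := Finset.card_le_card h2
  have h4 := hf u
  rw [p.length_support] at h1
  omega

lemma degOn_add_degOn_sdiff {R : SimpleGraph V} (h : R ≤ G) (x : V) :
    degOn R Finset.univ x + degOn (G \ R) Finset.univ x = degOn G Finset.univ x := by
  classical
  unfold degOn
  rw [← Finset.card_union_of_disjoint]
  · congr 1
    ext y
    have := @h x y
    simp only [Finset.mem_union, Finset.mem_filter, SimpleGraph.sdiff_adj]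
    tauto
  · rw [Finset.disjoint_left]
    intro y
    simp only [Finset.mem_filter, SimpleGraph.sdiff_adj]
    tauto

/-- If the fibres of `f` have `c + 1` elements, except for the singleton fibre of `s`, then
`s` is the only vertex of `fibreGraph f` whose degree is not `c`. -/
lemma degSum_fibreGraph [DecidableEq V] {f : V → ι} {s : V}
    (hs : (Finset.univ.filter fun y => f y = f s).card = 1)
    (hf : ∀ x, x ≠ s → (Finset.univ.filter fun y => f y = f x).card = c + 1) :
    degSum (fibreGraph f) Finset.univ + c = c * Fintype.card V := by
  have h : ∀ x, degOn (fibreGraph f) Finset.univ x + (if x = s then c else 0) = c := by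
    intro x
    have := degOn_fibreGraph f x
    split_ifs with hx
    · subst hx
      omega
    · have := hf x hx
      omega
  have := Finset.sum_congr (rfl : (Finset.univ : Finset V) = _) fun x _ => h x
  rw [Finset.sum_add_distrib] at this
  simpa [degSum, mul_comm] using this

/-- Let `G` be the union of two edge-disjoint graphs, one consisting of copies of `K_{c+1}` and an
isolated vertex `s`, the other of copies of `K_{d+1}` and an isolated vertex `t ≠ s`.
Then the vertex `t` of `G` transmits red. -/
theorem transmitter_of_fibres [DecidableEq V] {f : V → ι} {g : V → κ} {s t : V} {d : ℕ}
    (hc : 1 ≤ c) (hd : 3 ≤ d) (hcd : c < d) (hst : s ≠ t)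
    (hfg : ∀ x y, f x = f y → g x = g y → x = y)
    (hV : Fintype.card V = (c + 1) * (d + 1) + 1)
    (hs : (Finset.univ.filter fun y => f y = f s).card = 1)
    (hf : ∀ x, x ≠ s → (Finset.univ.filter fun y => f y = f x).card = c + 1)
    (ht : (Finset.univ.filter fun y => g y = g t).card = 1)
    (hg : ∀ x, x ≠ t → (Finset.univ.filter fun y => g y = g x).card = d + 1) :
    IsGood (fibreGraph f ⊔ fibreGraph g) (c + 2) (d + 2) ∧
      ∀ R, GoodColoring (fibreGraph f ⊔ fibreGraph g) R (c + 2) (d + 2) →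
        StrictEndpoint R t (c + 1) ∧ ∀ u, ¬ ((fibreGraph f ⊔ fibreGraph g) \ R).Adj t u := by
  refine ⟨⟨fibreGraph f, le_sup_left, not_hasNPath_fibreGraph fun x => ?_, ?_⟩, ?_⟩
  · by_cases hx : x = s
    · rw [hx]
      omega
    · exact (hf x hx).le
  · rw [fibreGraph_sup_sdiff hfg]
    refine not_hasNPath_fibreGraph fun x => ?_
    by_cases hx : x = t
    · rw [hx]
      omega
    · exact (hg x hx).le
  rintro R ⟨hRG, hR, hB⟩
  set G := fibreGraph f ⊔ fibreGraph g with hG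
  have hdeg : ∀ x, degOn R Finset.univ x + degOn (G \ R) Finset.univ x =
      degOn (fibreGraph f) Finset.univ x + degOn (fibreGraph g) Finset.univ x := by
    intro x
    rw [degOn_add_degOn_sdiff hRG, hG,
      ← degOn_add_degOn_sdiff (le_sup_left : fibreGraph f ≤ fibreGraph f ⊔ fibreGraph g),
      fibreGraph_sup_sdiff hfg]
  have hsum : degSum R Finset.univ + degSum (G \ R) Finset.univ =
      degSum (fibreGraph f) Finset.univ + degSum (fibreGraph g) Finset.univ := by
    simp only [degSum, ← Finset.sum_add_distrib, hdeg]
  have hsumf := degSum_fibreGraph hs hf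
  have hsumg := degSum_fibreGraph ht hg
  have hmodc : Fintype.card V % (c + 1) = 1 := by
    rw [hV, Nat.mul_add_mod, Nat.mod_eq_of_lt (by omega)]
  have hmodd : Fintype.card V % (d + 1) = 1 := by
    rw [hV, Nat.mul_add_mod_self_right, Nat.mod_eq_of_lt (by omega)]
  obtain ⟨-, -, hR1, -⟩ := degSum_stability (G := R) hc Finset.univ
    fun _ => length_le_of_not_hasNPath hR
  obtain ⟨-, -, hB1, hB2⟩ := degSum_stability (G := G \ R) (c := d) (by omega) Finset.univ
    fun _ => length_le_of_not_hasNPath hB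
  rw [Finset.card_univ] at hR1 hB1 hB2
  have hR3 := hR1 fun h => by
    rw [Nat.mod_eq_zero_of_dvd h] at hmodc
    omega
  have hB3 := hB1 fun h => by
    rw [Nat.mod_eq_zero_of_dvd h] at hmodd
    omega
  obtain ⟨w, -, hw0, hw⟩ := hB2 hd hmodd (by omega)
  have hft := degOn_fibreGraph f t
  have hgt := degOn_fibreGraph g t
  have hfs := degOn_fibreGraph f s
  rw [hf t hst.symm] at hft
  rw [ht] at hgt
  rw [hs] at hfs
  have hdt := hdeg t
  obtain rfl : t = w := by
    by_contra htw
    have := hw t (Finset.mem_univ t) htw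
    omega
  have hdR : ∀ x, 0 < degOn R Finset.univ x → c ≤ degOn R Finset.univ x := by
    intro x hx
    have hdx := hdeg x
    by_cases hxt : x = t
    · subst hxt
      omega
    have hgx := degOn_fibreGraph g x
    rw [hg x hxt] at hgx
    have hwx := hw x (Finset.mem_univ x) hxt
    by_cases hxs : x = s
    · subst hxs
      omega
    · have hfx := degOn_fibreGraph f x
      rw [hf x hxs] at hfx
      omega
  refine ⟨strictEndpoint_of_not_hasNPath hR (isPathEndpoint_of_le_degOn (by omega) hdR),
    fun u hu => ?_⟩
  have := degOn_pos hu
  omega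
end

section

variable (c d : ℕ)

/-- A grid with an extra point `none` is partitioned into its columns and `{none}`. -/
def columnIndex : Option (Fin (c + 1) × Fin (d + 1)) → Option (Fin (d + 1)) :=
  Option.map Prod.snd

/-- A grid with an extra point `none` is partitioned into its rows, with the corner replaced by
`none`, and a singleton consisting of the corner. -/
def rowIndex : Option (Fin (c + 1) × Fin (d + 1)) → Option (Fin (c + 1))
  | none => some 0
  | some p => if p = 0 then none else some p.1

lemma eq_of_columnIndex_eq_of_rowIndex_eq (x y : Option (Fin (c + 1) × Fin (d + 1)))
    (h1 : columnIndex c d x = columnIndex c d y) (h2 : rowIndex c d x = rowIndex c d y) :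
    x = y := by
  rcases x with _ | ⟨i, j⟩ <;> rcases y with _ | ⟨i', j'⟩ <;>
    simp [columnIndex, rowIndex] at *
  grind

lemma card_columnIndex_none :
    (Finset.univ.filter fun y => columnIndex c d y = columnIndex c d none).card = 1 := by
  rw [Finset.card_eq_one]
  refine ⟨none, ?_⟩
  ext y
  cases y <;> simp [columnIndex]

lemma card_columnIndex {x : Option (Fin (c + 1) × Fin (d + 1))} (hx : x ≠ none) :
    (Finset.univ.filter fun y => columnIndex c d y = columnIndex c d x).card = c + 1 := by
  obtain ⟨⟨i, j⟩, rfl⟩ := Option.ne_none_iff_exists'.1 hx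
  have : (Finset.univ.filter fun y => columnIndex c d y = columnIndex c d (some (i, j))) =
      Finset.univ.image fun i' : Fin (c + 1) => some (i', j) := by
    ext y
    rcases y with _ | ⟨i', j'⟩ <;> simp [columnIndex, eq_comm]
  rw [this, Finset.card_image_of_injective _ (fun _ _ h => by simpa using h), Finset.card_univ,
    Fintype.card_fin]

lemma card_rowIndex_corner :
    (Finset.univ.filter fun y => rowIndex c d y = rowIndex c d (some 0)).card = 1 := by
  rw [Finset.card_eq_one]
  refine ⟨some 0, ?_⟩
  ext y
  cases y <;> simp [rowIndex]

lemma card_rowIndex {x : Option (Fin (c + 1) × Fin (d + 1))} (hx : x ≠ some 0) :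
    (Finset.univ.filter fun y => rowIndex c d y = rowIndex c d x).card = d + 1 := by
  obtain ⟨i, hi⟩ : ∃ i, rowIndex c d x = some i := by
    cases x <;> simp_all [rowIndex]
  have : (Finset.univ.filter fun y => rowIndex c d y = rowIndex c d x) =
      Finset.univ.image fun j : Fin (d + 1) => if (i, j) = 0 then none else some (i, j) := by
    ext y
    simp only [Finset.mem_filter, Finset.mem_univ, true_and, hi, Finset.mem_image]
    simp only [ite_eq_iff, Prod.ext_iff, Prod.fst_zero, Prod.snd_zero]
    constructor
    · intro h
      refine ⟨y.elim 0 Prod.snd, ?_⟩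
      rcases y with _ | ⟨i', j'⟩ <;> simp [rowIndex, Prod.ext_iff] at h ⊢ <;> grind
    · rintro ⟨j, ⟨h, rfl⟩ | ⟨h, rfl⟩⟩ <;> simp [rowIndex, Prod.ext_iff] <;> grind
  rw [this, Finset.card_image_of_injective _ (fun _ _ h => by grind), Finset.card_univ,
    Fintype.card_fin]

end

end PathRamsey

/-- for 3 ≤ k < ℓ (with ℓ ≥ 5 when k = 3) there exists a
(k, ℓ, k−1)-red-transmitter. -/
theorem stmt3 (k ℓ : ℕ) (hk : 3 ≤ k) (hkl : k < ℓ) (h3 : k = 3 → 5 ≤ ℓ) :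
    ∃ (n : ℕ) (G : SimpleGraph (Fin n)) (v : Fin n),
      IsGood G k ℓ ∧
      ∀ R : SimpleGraph (Fin n), GoodColoring G R k ℓ →
        StrictEndpoint R v (k - 1) ∧ ∀ u, ¬ (G \ R).Adj v u := by
  obtain ⟨c, rfl⟩ := Nat.exists_eq_add_of_le' (show 2 ≤ k by omega)
  obtain ⟨d, rfl⟩ := Nat.exists_eq_add_of_le' (show 2 ≤ ℓ by omega)
  have hcard : Fintype.card (Option (Fin (c + 1) × Fin (d + 1))) = (c + 1) * (d + 1) + 1 := by
    simp
  let e := (Fintype.equivFinOfCardEq hcard).symm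
  have hfibre : ∀ {ι : Type} [DecidableEq ι] (f : Option (Fin (c + 1) × Fin (d + 1)) → ι) x,
      (Finset.univ.filter fun y => f (e y) = f (e x)).card =
        (Finset.univ.filter fun y => f y = f (e x)).card :=
    fun f x => Finset.card_equiv e (by simp)
  refine ⟨_, _, e.symm (some 0), PathRamsey.transmitter_of_fibres
    (f := PathRamsey.columnIndex c d ∘ e) (g := PathRamsey.rowIndex c d ∘ e) (s := e.symm none)
    (by omega) (by omega) (by omega) (by simp) (fun x y h1 h2 => e.injective <|
      PathRamsey.eq_of_columnIndex_eq_of_rowIndex_eq c d _ _ h1 h2) (by simp) ?_ ?_ ?_ ?_⟩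
  · refine (hfibre _ _).trans ?_
    rw [e.apply_symm_apply]
    exact PathRamsey.card_columnIndex_none c d
  · exact fun x hx => (hfibre _ _).trans
      (PathRamsey.card_columnIndex c d fun h => hx (by simp [← h]))
  · refine (hfibre _ _).trans ?_
    rw [e.apply_symm_apply]
    exact PathRamsey.card_rowIndex_corner c d
  · exact fun x hx => (hfibre _ _).trans
      (PathRamsey.card_rowIndex c d fun h => hx (by simp [← h]))
end

section
/- For every integer k ≥ 3 there exists a (k, k−1)-transmitter; that is, a (P_k, P_k)-good graph G with a vertex v such that in every (P_k, P_k)-good coloring of G, either v is a strict endpoint of a red P_{k−1} and is incident to no blue edge, or v is a strict endpoint of a blue P_{k−1} and is incident to no red edge. -/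
/-- `l` lists the vertices of a path of `R`, all of them in `s`, in order. -/
def IsPathIn {V : Type*} (R : SimpleGraph V) (s : Finset V) (l : List V) : Prop :=
  l.IsChain R.Adj ∧ l.Nodup ∧ ∀ x ∈ l, x ∈ s

open Classical in
/-- The number of neighbors of `x` in `s`. -/
noncomputable def degIn {V : Type*} (R : SimpleGraph V) (s : Finset V) (x : V) : ℕ :=
  (s.filter (R.Adj x)).card

section LongestPath

variable {V : Type*} {R : SimpleGraph V} {s : Finset V} {l : List V}

theorem exists_longest_path (hs : s.Nonempty) :
    ∃ l, l ≠ [] ∧ IsPathIn R s l ∧ ∀ l', IsPathIn R s l' → l'.length ≤ l.length := by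
  classical
  obtain ⟨v, hv⟩ := hs
  let p : ℕ → Prop := fun n => ∃ l, IsPathIn R s l ∧ l.length = n
  have hb : ∀ l, IsPathIn R s l → l.length ≤ s.card := fun l hl => by
    rw [← List.toFinset_card_of_nodup hl.2.1]
    exact Finset.card_le_card fun x hx => hl.2.2 x (List.mem_toFinset.1 hx)
  have h1 : p 1 := ⟨[v], ⟨by simp, by simp, by simpa using hv⟩, rfl⟩
  have h1s : 1 ≤ s.card := Finset.card_pos.2 ⟨v, hv⟩
  obtain ⟨l, hl, hlen⟩ := Nat.findGreatest_spec (P := p) h1s h1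
  refine ⟨l, ?_, hl, fun l' hl' => ?_⟩
  · rintro rfl
    have := Nat.le_findGreatest (P := p) h1s h1
    simp at hlen
    omega
  · rw [hlen]
    exact Nat.le_findGreatest (hb l' hl') ⟨l', hl', rfl⟩

/-- If the vertices of a longest path span a cycle, then no edge leaves them. -/
theorem closed_of_cyclic (hl : IsPathIn R s l)
    (hmax : ∀ l', IsPathIn R s l' → l'.length ≤ l.length)
    (hcyc : ∀ x ∈ l.getLast?, ∀ y ∈ l.head?, R.Adj x y)
    {x y : V} (hx : x ∈ l) (hy : y ∈ s) (hxy : R.Adj x y) : y ∈ l := by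
  by_contra hyl
  obtain ⟨a, b, rfl⟩ := List.append_of_mem hx
  obtain ⟨hc, hn, hm⟩ := hl
  have h1 := List.isChain_append.1 hc
  have : IsPathIn R s (y :: (x :: b ++ a)) := by
    refine ⟨?_, ?_, ?_⟩
    · rw [List.cons_append, List.isChain_cons_cons, ← List.cons_append, List.isChain_append]
      refine ⟨hxy.symm, h1.2.1, h1.1, fun u hu w hw => hcyc u ?_ w ?_⟩
      · rw [List.getLast?_append]
        simp_all
      · rw [List.head?_append]
        simp_all
    · rw [List.nodup_cons]
      refine ⟨by simp at hyl ⊢; tauto, (List.perm_append_comm.nodup_iff).1 hn⟩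
    · intro u hu
      simp only [List.mem_cons, List.mem_append] at hu hm
      rcases hu with rfl | hu
      · exact hy
      · exact hm u (by tauto)
  have := hmax _ this
  simp at this
  omega

theorem mem_of_adj_head (hl : IsPathIn R s l)
    (hmax : ∀ l', IsPathIn R s l' → l'.length ≤ l.length) (hne : l ≠ [])
    {y : V} (hy : y ∈ s) (hxy : R.Adj (l.head hne) y) : y ∈ l := by
  by_contra hyl
  obtain ⟨x, l, rfl⟩ := List.exists_cons_of_ne_nil hne
  have : IsPathIn R s (y :: x :: l) :=
    ⟨List.isChain_cons_cons.2 ⟨hxy.symm, hl.1⟩, List.nodup_cons.2 ⟨hyl, hl.2.1⟩, by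
      intro u hu
      rcases List.mem_cons.1 hu with rfl | hu
      · exact hy
      · exact hl.2.2 u hu⟩
  have := hmax _ this
  simp at this

theorem IsPathIn.reverse (hl : IsPathIn R s l) : IsPathIn R s l.reverse :=
  ⟨List.isChain_reverse.2 (hl.1.imp fun _ _ h => h.symm), List.nodup_reverse.2 hl.2.1,
    fun x hx => hl.2.2 x (List.mem_reverse.1 hx)⟩

theorem mem_of_adj_getLast (hl : IsPathIn R s l)
    (hmax : ∀ l', IsPathIn R s l' → l'.length ≤ l.length) (hne : l ≠ [])
    {y : V} (hy : y ∈ s) (hxy : R.Adj (l.getLast hne) y) : y ∈ l := by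
  have := mem_of_adj_head hl.reverse (by simpa using hmax) (by simpa using hne) hy
    (by simpa using hxy)
  simpa using this

/-- Ore's rotation: if the degrees of the endpoints of a longest path sum to at least its number
of vertices, then no edge leaves the path. -/
theorem closed_of_length_le (hl : IsPathIn R s l)
    (hmax : ∀ l', IsPathIn R s l' → l'.length ≤ l.length) (hne : l ≠ [])
    (hdeg : l.length ≤ degIn R s (l.head hne) + degIn R s (l.getLast hne))
    {x y : V} (hx : x ∈ l) (hy : y ∈ s) (hxy : R.Adj x y) : y ∈ l := by
  classical
  have hpos : 0 < l.length := List.length_pos_iff.2 hne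
  let g : ℕ → V := fun i => l.getD i (l.head hne)
  have hg : ∀ i (h : i < l.length), g i = l[i] := fun i h => by simp [g, h]
  let I := (Finset.range (l.length - 1)).filter fun i => R.Adj (l.head hne) (g (i + 1))
  let J := (Finset.range (l.length - 1)).filter fun i => R.Adj (l.getLast hne) (g i)
  have hI : degIn R s (l.head hne) ≤ I.card := by
    refine le_trans (Finset.card_le_card ?_)
      (Finset.card_image_le (s := I) (f := fun i => g (i + 1)))
    intro z hz
    rw [Finset.mem_filter] at hz
    obtain ⟨i, hi, rfl⟩ := List.getElem_of_mem (mem_of_adj_head hl hmax hne hz.1 hz.2)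
    obtain _ | i := i
    · exact absurd hz.2 (by rw [List.head_eq_getElem]; exact R.irrefl)
    · exact Finset.mem_image.2 ⟨i, by simp [I, hg _ hi, hz.2]; omega, hg _ hi⟩
  have hJ : degIn R s (l.getLast hne) ≤ J.card := by
    refine le_trans (Finset.card_le_card ?_) (Finset.card_image_le (s := J) (f := g))
    intro z hz
    rw [Finset.mem_filter] at hz
    obtain ⟨i, hi, rfl⟩ := List.getElem_of_mem (mem_of_adj_getLast hl hmax hne hz.1 hz.2)
    have : i ≠ l.length - 1 := by
      rintro rfl
      exact absurd hz.2 (by rw [List.getLast_eq_getElem]; exact R.irrefl)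
    exact Finset.mem_image.2 ⟨i, by simp [J, hg _ hi, hz.2]; omega, hg _ hi⟩
  have hIJ : (I ∩ J).Nonempty := by
    have h1 : (I ∪ J).card ≤ l.length - 1 := by
      simpa using Finset.card_le_card (show I ∪ J ⊆ Finset.range (l.length - 1) from
        Finset.union_subset (Finset.filter_subset _ _) (Finset.filter_subset _ _))
    have h2 := Finset.card_union_add_card_inter I J
    rw [← Finset.card_pos]
    omega
  obtain ⟨i, hi⟩ := hIJ
  simp only [I, J, Finset.mem_inter, Finset.mem_filter, Finset.mem_range] at hi
  obtain ⟨⟨hi, hi1⟩, -, hi2⟩ := hi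
  rw [hg _ (by omega)] at hi1 hi2
  have hsplit := List.take_append_drop (i + 1) l
  set a := l.take (i + 1) with ha
  set b := l.drop (i + 1) with hb
  have hbne : b ≠ [] := by simp [hb]; omega
  have hane : a ≠ [] := by simp [ha]; omega
  have halast : a.getLast hane = l[i] := by
    simp [ha, List.getLast_eq_getElem]
    congr 1; omega
  have hbhead : b.head hbne = l[i + 1] := by simp [hb, List.head_eq_getElem]
  have hahead : a.head hane = l.head hne := by simp [ha, List.head_eq_getElem]
  have hblast : b.getLast hbne = l.getLast hne := by simp [hb]
  have hperm : (a ++ b.reverse).Perm l := by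
    conv_rhs => rw [← hsplit]
    exact (List.reverse_perm b).append_left a
  have hab := hl.1
  rw [← hsplit, List.isChain_append] at hab
  have hc : IsPathIn R s (a ++ b.reverse) := by
    refine ⟨List.isChain_append.2 ⟨hab.1,
      List.isChain_reverse.2 (hab.2.1.imp fun _ _ h => h.symm), ?_⟩, hperm.nodup_iff.2 hl.2.1,
      fun x hx => hl.2.2 x (hperm.mem_iff.1 hx)⟩
    intro u hu w hw
    rw [List.getLast?_eq_getLast_of_ne_nil hane] at hu
    rw [List.head?_reverse, List.getLast?_eq_getLast_of_ne_nil hbne] at hw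
    simp only [Option.mem_def, Option.some.injEq] at hu hw
    rw [← hu, ← hw, halast, hblast]
    exact hi2.symm
  rw [← hperm.mem_iff] at hx ⊢
  refine closed_of_cyclic hc (by rwa [hperm.length_eq]) ?_ hx hy hxy
  intro u hu w hw
  rw [List.getLast?_append, List.getLast?_reverse, List.head?_eq_some_head hbne] at hu
  rw [List.head?_append, List.head?_eq_some_head hane] at hw
  simp only [Option.some_or, Option.mem_def, Option.some.injEq] at hu hw
  rw [← hu, ← hw, hbhead, hahead]
  exact hi1.symm

end LongestPath

section Extremal

variable {V : Type*} {R : SimpleGraph V} {s U : Finset V} {D : ℕ}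

open Classical in
/-- The vertices of `s` outside `U` have average degree at most `D` within `s`; in case of
equality every vertex of `s ∩ U` is isolated in `s` or lies in a clique of `D + 1` vertices. -/
def AvgDegLE (R : SimpleGraph V) (D : ℕ) (s U : Finset V) : Prop :=
  ∑ z ∈ s \ U, degIn R s z ≤ D * (s \ U).card ∧
    (∑ z ∈ s \ U, degIn R s z = D * (s \ U).card →
      ∀ u ∈ U, u ∈ s → degIn R s u = 0 ∨ ∃ K ⊆ s, u ∈ K ∧ R.IsNClique (D + 1) K)

open Classical in
theorem degIn_mono {s t : Finset V} (h : s ⊆ t) (x : V) : degIn R s x ≤ degIn R t x :=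
  Finset.card_le_card (Finset.filter_subset_filter _ h)

theorem degIn_pos_iff {x : V} : 0 < degIn R s x ↔ ∃ y ∈ s, R.Adj x y := by
  classical
  simp [degIn, Finset.card_pos, Finset.Nonempty]

open Classical in
theorem degIn_eq_erase_add {x : V} (hx : x ∈ s) (z : V) :
    degIn R s z = degIn R (s.erase x) z + if R.Adj x z then 1 else 0 := by
  unfold degIn
  rw [Finset.filter_erase]
  split_ifs with h
  · rw [Finset.card_erase_add_one]
    simp [hx, h.symm]
  · rw [Finset.erase_eq_of_notMem]
    · rfl
    · simp only [Finset.mem_filter, not_and]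
      exact fun _ h' => h h'.symm

open Classical in
theorem sum_degIn_eq_erase_add {x : V} (hx : x ∈ s) (t : Finset V) :
    ∑ z ∈ t, degIn R s z = ∑ z ∈ t, degIn R (s.erase x) z + degIn R t x := by
  rw [Finset.sum_congr rfl fun z _ => degIn_eq_erase_add hx z, Finset.sum_add_distrib]
  simp [degIn]

open Classical in
theorem degIn_add_one_le {t : Finset V} {x u : V} (ht : t ⊆ s) (hu : u ∈ s) (hut : u ∉ t)
    (hxu : R.Adj x u) : degIn R t x + 1 ≤ degIn R s x := by
  have h := degIn_mono (R := R) (Finset.insert_subset hu ht) x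
  have h' := degIn_eq_erase_add (R := R) (Finset.mem_insert_self u t) x
  rw [Finset.erase_insert hut, if_pos hxu.symm] at h'
  omega

open Classical in
theorem AvgDegLE.of_erase_low {x : V} (hx : x ∈ s) (hxU : x ∉ U) (hdeg : 2 * degIn R s x ≤ D)
    (h : AvgDegLE R D (s.erase x) U) : AvgDegLE R D s U := by
  set t := s.erase x \ U with ht
  have hst : s \ U = insert x t := by
    ext z
    by_cases hz : z = x
    · subst hz; simp [hx, hxU]
    · simp [ht, hz]
  have hxt : x ∉ t := by simp [ht]
  have hts : t ⊆ s := fun z hz => by simp [ht] at hz; tauto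
  have hsum : ∑ z ∈ s \ U, degIn R s z
      = degIn R s x + (∑ z ∈ t, degIn R (s.erase x) z + degIn R t x) := by
    rw [hst, Finset.sum_insert hxt, sum_degIn_eq_erase_add hx]
  have hcard : D * (s \ U).card = D * t.card + D := by
    rw [hst, Finset.card_insert_of_notMem hxt, mul_add, mul_one]
  have hle := degIn_mono (R := R) hts x
  obtain ⟨h1, h2⟩ := h
  rw [← ht] at h1 h2
  refine ⟨by omega, fun heq u hu hus => ?_⟩
  have hux : u ≠ x := by rintro rfl; exact hxU hu
  rcases h2 (by omega) u hu (by simp [hux, hus]) with h0 | ⟨K, hK, huK⟩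
  · left
    rw [degIn_eq_erase_add hx, h0, if_neg]
    intro hadj
    have := degIn_add_one_le hts hus (by simp [ht, hu]) hadj
    omega
  · exact Or.inr ⟨K, hK.trans (Finset.erase_subset _ _), huK⟩

open Classical in
theorem AvgDegLE.of_erase_isolated {x : V} (hx : x ∈ s) (hxU : x ∈ U) (hdeg : degIn R s x = 0)
    (h : AvgDegLE R D (s.erase x) U) : AvgDegLE R D s U := by
  have hadj : ∀ z ∈ s, ¬ R.Adj x z := fun z hz hadj => by
    have := degIn_pos_iff.2 ⟨z, hz, hadj⟩
    omega
  have hst : s \ U = s.erase x \ U := by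
    ext z
    by_cases hz : z = x
    · subst hz; simp [hxU]
    · simp [hz]
  have hd : ∀ z ∈ s, degIn R s z = degIn R (s.erase x) z := fun z hz => by
    rw [degIn_eq_erase_add hx, if_neg (hadj z hz), add_zero]
  have hsum : ∑ z ∈ s \ U, degIn R s z = ∑ z ∈ s.erase x \ U, degIn R (s.erase x) z := by
    rw [← hst]
    exact Finset.sum_congr rfl fun z hz => hd z (Finset.mem_sdiff.1 hz).1
  unfold AvgDegLE at *
  rw [hsum, hst]
  refine ⟨h.1, fun heq u hu hus => ?_⟩
  by_cases hux : u = x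
  · exact Or.inl (hux ▸ hdeg)
  rw [hd u hus]
  refine (h.2 heq u hu (by simp [hux, hus])).imp_right ?_
  rintro ⟨K, hK, huK⟩
  exact ⟨K, hK.trans (Finset.erase_subset _ _), huK⟩

open Classical in
theorem AvgDegLE.of_erase_swap {x y : V} (hx : x ∈ s) (hy : y ∈ s) (hxy : x ≠ y) (hxU : x ∈ U)
    (hyU : y ∉ U) (hyd : 0 < degIn R s y) (hdeg : degIn R s x + degIn R s y ≤ D)
    (hU : ∀ u ∈ U, R.Adj x u → u = x)
    (h : AvgDegLE R D (s.erase x) (insert y (U.erase x))) : AvgDegLE R D s U := by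
  set t := s.erase x \ insert y (U.erase x) with ht
  have hst : s \ U = insert y t := by
    ext z
    by_cases hz : z = y
    · subst hz; simp [hy, hyU]
    · by_cases hz' : z = x
      · subst hz'; simp [ht, hz, hxU]
      · simp [ht, hz, hz']
  have hyt : y ∉ t := by simp [ht]
  have hts : t ⊆ s := fun z hz => by simp [ht] at hz; tauto
  have hsum : ∑ z ∈ s \ U, degIn R s z
      = degIn R s y + (∑ z ∈ t, degIn R (s.erase x) z + degIn R t x) := by
    rw [hst, Finset.sum_insert hyt, sum_degIn_eq_erase_add hx]
  have hcard : D * (s \ U).card = D * t.card + D := by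
    rw [hst, Finset.card_insert_of_notMem hyt, mul_add, mul_one]
  have hle := degIn_mono (R := R) hts x
  obtain ⟨h1, h2⟩ := h
  rw [← ht] at h1 h2
  refine ⟨by omega, fun heq u hu hus => ?_⟩
  have h2 := h2 (by omega)
  by_cases hux : u = x
  · subst hux
    left
    have hadj : ¬ R.Adj u y := fun hadj => by
      have := degIn_add_one_le hts hy hyt hadj
      omega
    rcases h2 y (by simp) (by simp [hy, hxy.symm]) with h0 | ⟨K, hK, hyK, hc⟩
    · have := degIn_eq_erase_add (R := R) hx y
      rw [if_neg hadj] at this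
      omega
    · have : K.erase y ⊆ s.filter (R.Adj y) := fun z hz => by
        rw [Finset.mem_erase] at hz
        exact Finset.mem_filter.2 ⟨Finset.mem_of_mem_erase (hK hz.2),
          hc.1 hyK hz.2 hz.1.symm⟩
      have := Finset.card_le_card this
      rw [Finset.card_erase_of_mem hyK, hc.2] at this
      change _ ≤ degIn R s y at this
      omega
  · rcases h2 u (by simp [hux, hu]) (by simp [hux, hus]) with h0 | ⟨K, hK, huK⟩
    · left
      rw [degIn_eq_erase_add hx, h0, if_neg fun hadj => hux (hU u hu hadj)]
    · exact Or.inr ⟨K, hK.trans (Finset.erase_subset _ _), huK⟩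

open Classical in
theorem AvgDegLE.of_sdiff_closed {P : Finset V} (hP : P ⊆ s) (hcard : P.card ≤ D + 1)
    (hP2 : 2 ≤ P.card) (hU : ∀ u ∈ P, ∀ w ∈ P, u ∈ U → w ∈ U → u = w)
    (hclosed : ∀ x ∈ P, ∀ y ∈ s, R.Adj x y → y ∈ P)
    (h : AvgDegLE R D (s \ P) U) : AvgDegLE R D s U := by
  have hdP : ∀ x ∈ P, s.filter (R.Adj x) ⊆ P.erase x := fun x hx z hz => by
    rw [Finset.mem_filter] at hz
    exact Finset.mem_erase.2 ⟨hz.2.ne', hclosed x hx z hz.1 hz.2⟩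
  have hdP' : ∀ x ∈ P, degIn R s x ≤ P.card - 1 := fun x hx => by
    rw [← Finset.card_erase_of_mem hx]
    exact Finset.card_le_card (hdP x hx)
  have hd : ∀ x ∈ s \ P, degIn R s x = degIn R (s \ P) x := fun x hx => by
    rw [Finset.mem_sdiff] at hx
    unfold degIn
    congr 1
    ext z
    simp only [Finset.mem_filter, Finset.mem_sdiff]
    exact ⟨fun hz => ⟨⟨hz.1, fun hzP => hx.2 (hclosed z hzP x hx.1 hz.2.symm)⟩, hz.2⟩,
      fun hz => ⟨hz.1.1, hz.2⟩⟩
  have hst : s \ U = (P \ U) ∪ ((s \ P) \ U) := by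
    ext z
    by_cases hz : z ∈ P
    · simp [hz, hP hz]
    · simp [hz]
  have hdisj : Disjoint (P \ U) ((s \ P) \ U) := by
    rw [Finset.disjoint_left]
    intro z hz hz'
    simp at hz hz'
    tauto
  have hsum : ∑ z ∈ s \ U, degIn R s z
      = ∑ z ∈ P \ U, degIn R s z + ∑ z ∈ (s \ P) \ U, degIn R (s \ P) z := by
    rw [hst, Finset.sum_union hdisj]
    congr 1
    exact Finset.sum_congr rfl fun z hz => hd z (Finset.mem_sdiff.1 hz).1
  have hcards : D * (s \ U).card = D * (P \ U).card + D * ((s \ P) \ U).card := by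
    rw [hst, Finset.card_union_of_disjoint hdisj, mul_add]
  have hdD : ∀ x ∈ P \ U, degIn R s x ≤ D := fun x hx =>
    (hdP' x (Finset.mem_sdiff.1 hx).1).trans (by omega)
  have hPsum : ∑ z ∈ P \ U, degIn R s z ≤ D * (P \ U).card := by
    have := Finset.sum_le_card_nsmul _ _ _ hdD
    rwa [smul_eq_mul, mul_comm] at this
  obtain ⟨h1, h2⟩ := h
  refine ⟨by omega, fun heq u hu hus => ?_⟩
  by_cases huP : u ∈ P
  · have hPeq : ∑ z ∈ P \ U, degIn R s z = ∑ _z ∈ P \ U, D := by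
      rw [Finset.sum_const, smul_eq_mul, mul_comm]
      omega
    have hall := (Finset.sum_eq_sum_iff_of_le hdD).1 hPeq
    have hmem : ∀ x ∈ P, x ≠ u → degIn R s x = D := fun x hx hxu =>
      hall x (Finset.mem_sdiff.2 ⟨hx, fun hxU => hxu (hU x hx u huP hxU hu)⟩)
    obtain ⟨x, hx, hxu⟩ := Finset.exists_mem_ne hP2 u
    have hPc : P.card = D + 1 := by
      have := hmem x hx hxu
      have := hdP' x hx
      omega
    have hadj : ∀ x ∈ P, x ≠ u → ∀ y ∈ P, x ≠ y → R.Adj x y := fun x hx hxu y hy hxy => by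
      have := Finset.eq_of_subset_of_card_le (hdP x hx) (by
        rw [Finset.card_erase_of_mem hx, hPc]
        exact (hmem x hx hxu).ge)
      have hy' : y ∈ P.erase x := Finset.mem_erase.2 ⟨hxy.symm, hy⟩
      rw [← this] at hy'
      exact (Finset.mem_filter.1 hy').2
    refine Or.inr ⟨P, hP, huP, ⟨fun x hx y hy hxy => ?_, hPc⟩⟩
    by_cases hxu : x = u
    · exact (hadj y hy (fun h => hxy (hxu.trans h.symm)) x hx hxy.symm).symm
    · exact hadj x hx hxu y hy hxy
  · have hus' : u ∈ s \ P := Finset.mem_sdiff.2 ⟨hus, huP⟩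
    rw [hd u hus']
    refine (h2 (by omega) u hu hus').imp_right ?_
    rintro ⟨K, hK, huK⟩
    exact ⟨K, hK.trans Finset.sdiff_subset, huK⟩

theorem IsPathIn.reachable {l : List V} (hl : IsPathIn R s l) {x y : V} (hx : x ∈ l)
    (hy : y ∈ l) : R.Reachable x y := by
  have hne : l ≠ [] := List.ne_nil_of_mem hx
  let p := SimpleGraph.Walk.ofSupport l hne hl.1
  have hp : p.support = l := SimpleGraph.Walk.support_ofSupport hne hl.1
  have h : ∀ z ∈ l, R.Reachable (l.head hne) z := fun z hz => by
    classical
    exact ⟨p.takeUntil z (by rwa [hp])⟩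
  exact (h x hx).symm.trans (h y hy)

open Classical in
/-- If `R` has no path on `D + 2` vertices, then outside a set `U` meeting every component at
most once the average degree is at most `D`. -/
theorem avgDegLE (hD : ∀ l : List V, l.IsChain R.Adj → l.Nodup → l.length ≤ D + 1)
    (s U : Finset V) (hU : ∀ u ∈ U, ∀ w ∈ U, R.Reachable u w → u = w) : AvgDegLE R D s U := by
  induction hn : s.card using Nat.strong_induction_on generalizing s U with
  | _ n ih =>
  subst hn
  rcases s.eq_empty_or_nonempty with rfl | hs
  · simp [AvgDegLE]
  obtain ⟨l, hne, hl, hmax⟩ := exists_longest_path (R := R) hs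
  have her : ∀ x ∈ s, (s.erase x).card < s.card := fun x hx => Finset.card_erase_lt_of_mem hx
  have hx := List.head_mem hne
  have hy := List.getLast_mem hne
  have hxy := hl.reachable hx hy
  have hclosed := closed_of_length_le hl hmax hne
  set x := l.head hne with hxdef
  set y := l.getLast hne with hydef
  have hxs := hl.2.2 x hx
  have hys := hl.2.2 y hy
  have hlen := hD l hl.1 hl.2.1
  by_cases hx0 : degIn R s x = 0
  · by_cases hxU : x ∈ U
    · exact .of_erase_isolated hxs hxU hx0 (ih _ (her x hxs) _ _ hU rfl)
    · exact .of_erase_low hxs hxU (by omega) (ih _ (her x hxs) _ _ hU rfl)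
  have hlen2 : 2 ≤ l.length := by
    by_contra hlt
    obtain ⟨z, hz, hxz⟩ := degIn_pos_iff.1 (Nat.pos_of_ne_zero hx0)
    have hzl := mem_of_adj_head hl hmax hne hz hxz
    obtain ⟨a, rfl⟩ := List.length_eq_one_iff.1
      (show l.length = 1 by have := List.length_pos_of_mem hx; omega)
    simp at hzl
    simp [hxdef, hzl] at hxz
  have hnexy : x ≠ y := by
    intro h
    rw [hxdef, hydef, List.head_eq_getElem, List.getLast_eq_getElem, hl.2.1.getElem_inj_iff] at h
    omega
  have hydeg : 0 < degIn R s y := by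
    refine degIn_pos_iff.2 ⟨l[l.length - 2], hl.2.2 _ (List.getElem_mem _), ?_⟩
    have := List.isChain_iff_getElem.1 hl.1 (l.length - 2) (by omega)
    rw [hydef, List.getLast_eq_getElem]
    convert this.symm using 2
    omega
  have hswap : ∀ a ∈ s, ∀ b ∈ s, a ≠ b → R.Reachable a b → a ∈ U → b ∉ U → 0 < degIn R s b →
      degIn R s a + degIn R s b ≤ D → AvgDegLE R D s U := by
    intro a ha b hb hab hr haU hbU hb0 hdeg
    refine .of_erase_swap ha hb hab haU hbU hb0 hdeg
      (fun u hu hadj => (hU a haU u hu hadj.reachable).symm) (ih _ (her a ha) _ _ ?_ rfl)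
    intro u hu w hw huw
    simp only [Finset.mem_insert, Finset.mem_erase] at hu hw
    rcases hu with rfl | ⟨hua, hu⟩ <;> rcases hw with rfl | ⟨hwa, hw⟩
    · rfl
    · exact absurd (hU a haU w hw (hr.trans huw)).symm hwa
    · exact absurd (hU u hu a haU (huw.trans hr.symm)) hua
    · exact hU u hu w hw huw
  by_cases hsum : l.length ≤ degIn R s x + degIn R s y
  · have hc : l.toFinset.card = l.length := List.toFinset_card_of_nodup hl.2.1
    have hsub : l.toFinset ⊆ s := fun z hz => hl.2.2 z (List.mem_toFinset.1 hz)
    refine .of_sdiff_closed (P := l.toFinset) hsub (by omega)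
      (by omega) ?_ ?_ (ih _ ?_ _ _ hU rfl)
    · intro u hu w hw huU hwU
      rw [List.mem_toFinset] at hu hw
      exact hU u huU w hwU (hl.reachable hu hw)
    · intro u hu w hw huw
      rw [List.mem_toFinset] at hu ⊢
      exact hclosed hsum hu hw huw
    · have := Finset.card_le_card hsub
      rw [Finset.card_sdiff_of_subset hsub]
      omega
  · by_cases hxU : x ∈ U
    · exact hswap x hxs y hys hnexy hxy hxU (fun hyU => hnexy (hU x hxU y hyU hxy)) hydeg
        (by omega)
    · by_cases hyU : y ∈ U
      · exact hswap y hys x hxs hnexy.symm hxy.symm hyU hxU (Nat.pos_of_ne_zero hx0) (by omega)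
      · by_cases hlow : 2 * degIn R s x ≤ D
        · exact .of_erase_low hxs hxU hlow (ih _ (her x hxs) _ _ hU rfl)
        · exact .of_erase_low hys hyU (by omega) (ih _ (her y hys) _ _ hU rfl)

end Extremal

section Bridge

variable {V : Type*} {R : SimpleGraph V} {n : ℕ}

theorem isPathEndpoint_of_isChain {l : List V} (hne : l ≠ []) (hc : l.IsChain R.Adj)
    (hn : l.Nodup) : IsPathEndpoint R (l.head hne) l.length := by
  refine ⟨_, SimpleGraph.Walk.ofSupport l hne hc, ?_, ?_⟩
  · rw [SimpleGraph.Walk.isPath_def, SimpleGraph.Walk.support_ofSupport]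
    exact hn
  · rw [← SimpleGraph.Walk.length_support, SimpleGraph.Walk.support_ofSupport]

theorem length_le_of_not_hasNPath (h : ¬ HasNPath R (n + 1)) (l : List V)
    (hc : l.IsChain R.Adj) (hn : l.Nodup) : l.length ≤ n := by
  by_contra! hlt
  have hlen : (l.take (n + 1)).length = n + 1 := by simp; omega
  have hne : l.take (n + 1) ≠ [] := by
    rw [← List.length_pos_iff]
    omega
  obtain ⟨w, p, hp, hpl⟩ :=
    isPathEndpoint_of_isChain hne (hc.take _) (hn.sublist (List.take_sublist _ _))
  exact h ⟨_, w, p, hp, hpl.trans hlen⟩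

theorem not_hasNPath_of_length_le
    (h : ∀ l : List V, l.IsChain R.Adj → l.Nodup → l.length ≤ n) : ¬ HasNPath R (n + 1) := by
  rintro ⟨u, w, p, hp, hl⟩
  have := h p.support p.isChain_adj_support hp.support_nodup
  rw [SimpleGraph.Walk.length_support] at this
  omega

theorem strictEndpoint_of_isNClique {v : V} {K : Finset V} (h : ¬ HasNPath R (n + 1))
    (hv : v ∈ K) (hK : R.IsNClique n K) : StrictEndpoint R v n := by
  classical
  constructor
  · have hnodup : (v :: (K.erase v).toList).Nodup :=
      List.nodup_cons.2 ⟨by simp, Finset.nodup_toList _⟩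
    have hmem : ∀ x ∈ v :: (K.erase v).toList, x ∈ K := by
      simp only [List.mem_cons, Finset.mem_toList, Finset.mem_erase]
      rintro x (rfl | hx)
      exacts [hv, hx.2]
    have hc : (v :: (K.erase v).toList).IsChain R.Adj :=
      (List.Pairwise.imp_of_mem (fun ha hb hab => hK.1 (hmem _ ha) (hmem _ hb) hab)
        hnodup).isChain
    have := isPathEndpoint_of_isChain (List.cons_ne_nil _ _) hc hnodup
    rwa [List.length_cons, Finset.length_toList, Finset.card_erase_add_one hv, hK.2] at this
  · rintro y ⟨w, p, hp, rfl⟩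
    rw [← SimpleGraph.Walk.length_support]
    exact length_le_of_not_hasNPath h _ p.isChain_adj_support hp.support_nodup

theorem degIn_sdiff_add {G : SimpleGraph V} (hR : R ≤ G) (s : Finset V) (x : V) :
    degIn R s x + degIn (G \ R) s x = degIn G s x := by
  classical
  unfold degIn
  rw [← Finset.card_filter_add_card_filter_not (s := s.filter (G.Adj x)) (R.Adj x),
    Finset.filter_filter, Finset.filter_filter]
  congr 2
  · ext y
    simp only [Finset.mem_filter, and_congr_right_iff]
    exact fun _ => ⟨fun h => ⟨hR h, h⟩, And.right⟩
  · ext y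
    simp [SimpleGraph.sdiff_adj]

end Bridge

section Construction

/-- The disjoint union of the complete graphs on the fibers of `f`. -/
def fiberGraph {V α : Type*} (f : V → α) : SimpleGraph V where
  Adj x y := x ≠ y ∧ f x = f y
  symm := ⟨fun _ _ h => ⟨h.1.symm, h.2.symm⟩⟩
  loopless := ⟨fun _ h => h.1 rfl⟩

theorem length_le_of_isChain_fiberGraph {V α : Type*} [Fintype V] [DecidableEq α] {f : V → α}
    {n : ℕ} (hf : ∀ x, (Finset.univ.filter fun y => f y = f x).card ≤ n) (l : List V)
    (hc : l.IsChain (fiberGraph f).Adj) (hn : l.Nodup) : l.length ≤ n := by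
  classical
  obtain rfl | ⟨x, l, rfl⟩ : l = [] ∨ ∃ x l', l = x :: l' := by cases l <;> simp
  · simp
  have hx : ∀ y ∈ x :: l, f y = f x := by
    have h : ((x :: l).map f).IsChain (· = ·) := (List.isChain_map f).2 (hc.imp fun _ _ h => h.2)
    have h := List.isChain_iff_pairwise.1 h
    rw [List.map_cons, List.pairwise_cons] at h
    intro y hy
    rcases List.mem_cons.1 hy with rfl | hy
    · rfl
    · exact (h.1 _ (List.mem_map_of_mem hy)).symm
  rw [← List.toFinset_card_of_nodup hn]
  refine (Finset.card_le_card fun y hy => ?_).trans (hf x)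
  simpa using hx y (List.mem_toFinset.1 hy)

variable {d : ℕ}

/-- The red classes: blocks of `d` consecutive numbers. The last vertex is a class of its own. -/
def redClass (d : ℕ) (t : Fin (d ^ 3 + 1)) : ℕ := t / d

/-- The blue classes: numbers congruent modulo `d` in a block of `d ^ 2` consecutive positive
numbers. The vertex `0` is a class of its own. -/
def blueClass (d : ℕ) (t : Fin (d ^ 3 + 1)) : ℕ × ℕ := ((t + (d ^ 2 - 1)) / d ^ 2, t % d)

theorem card_redClass_le (hd : 0 < d) (x : Fin (d ^ 3 + 1)) :
    (Finset.univ.filter fun y => redClass d y = redClass d x).card ≤ d := by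
  conv_rhs => rw [← Finset.card_range d]
  refine Finset.card_le_card_of_injOn (fun y => (y : ℕ) % d)
    (fun y _ => by simpa using Nat.mod_lt _ hd) ?_
  intro y hy z hz hyz
  replace hy : (y : ℕ) / d = x / d := (Finset.mem_filter.1 (Finset.mem_coe.1 hy)).2
  replace hz : (z : ℕ) / d = x / d := (Finset.mem_filter.1 (Finset.mem_coe.1 hz)).2
  replace hyz : (y : ℕ) % d = z % d := hyz
  ext
  rw [← Nat.div_add_mod (y : ℕ) d, ← Nat.div_add_mod (z : ℕ) d, hy, hz, hyz]

theorem card_blueClass_le (hd : 0 < d) (x : Fin (d ^ 3 + 1)) :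
    (Finset.univ.filter fun y => blueClass d y = blueClass d x).card ≤ d := by
  conv_rhs => rw [← Finset.card_range d]
  refine Finset.card_le_card_of_injOn (fun y => ((y : ℕ) + (d ^ 2 - 1)) / d % d)
    (fun y _ => by simpa using Nat.mod_lt _ hd) ?_
  intro y hy z hz hyz
  replace hy := Prod.mk.inj (Finset.mem_filter.1 (Finset.mem_coe.1 hy)).2
  replace hz := Prod.mk.inj (Finset.mem_filter.1 (Finset.mem_coe.1 hz)).2
  replace hyz : ((y : ℕ) + (d ^ 2 - 1)) / d % d = (z + (d ^ 2 - 1)) / d % d := hyz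
  have h1 := hy.1.trans hz.1.symm
  have h2 : ((y : ℕ) + (d ^ 2 - 1)) % d = (z + (d ^ 2 - 1)) % d :=
    Nat.ModEq.add_right _ (hy.2.trans hz.2.symm)
  rw [pow_two, ← Nat.div_div_eq_div_mul, ← Nat.div_div_eq_div_mul, ← pow_two] at h1
  have h3 : ((y : ℕ) + (d ^ 2 - 1)) / d = (z + (d ^ 2 - 1)) / d := by
    rw [← Nat.div_add_mod (((y : ℕ) + (d ^ 2 - 1)) / d) d, h1, hyz, Nat.div_add_mod]
  have h4 : (y : ℕ) + (d ^ 2 - 1) = z + (d ^ 2 - 1) := by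
    rw [← Nat.div_add_mod ((y : ℕ) + (d ^ 2 - 1)) d, h3, h2, Nat.div_add_mod]
  ext
  omega

theorem le_card_redClass (hd : 0 < d) {x : Fin (d ^ 3 + 1)} (hx : (x : ℕ) < d ^ 3) :
    d ≤ (Finset.univ.filter fun y => redClass d y = redClass d x).card := by
  have h3 : d ^ 3 = d ^ 2 * d := pow_succ d 2
  have h : (x : ℕ) / d + 1 ≤ d ^ 2 := by
    rw [Nat.succ_le_iff, Nat.div_lt_iff_lt_mul hd]
    omega
  have h := Nat.mul_le_mul_right d h
  rw [add_mul, one_mul, ← h3] at h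
  conv_lhs => rw [← Fintype.card_fin d, ← Finset.card_univ]
  refine Finset.card_le_card_of_injOn (fun j : Fin d => ⟨(x : ℕ) / d * d + j, by omega⟩) ?_ ?_
  · intro j _
    refine Finset.mem_coe.2 (Finset.mem_filter.2 ⟨Finset.mem_univ _, ?_⟩)
    simp only [redClass]
    rw [mul_comm, Nat.mul_add_div hd, Nat.div_eq_of_lt j.2, add_zero]
  · intro i _ j _ hij
    simp only [Fin.mk.injEq] at hij
    ext
    omega

theorem le_card_blueClass (hd : 0 < d) {x : Fin (d ^ 3 + 1)} (hx : 0 < (x : ℕ)) :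
    d ≤ (Finset.univ.filter fun y => blueClass d y = blueClass d x).card := by
  have hd2 : 0 < d ^ 2 := by positivity
  have h3 : d ^ 3 = d * d ^ 2 := pow_succ' d 2
  have h : ((x : ℕ) - 1) / d ^ 2 + 1 ≤ d := by
    rw [Nat.succ_le_iff, Nat.div_lt_iff_lt_mul hd2]
    omega
  have h := Nat.mul_le_mul_right (d ^ 2) h
  rw [add_mul, one_mul, ← h3] at h
  obtain ⟨e, he1, hed, hemod⟩ : ∃ e, 1 ≤ e ∧ e ≤ d ∧ e % d = x % d := by
    rcases Nat.eq_zero_or_pos ((x : ℕ) % d) with h0 | h0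
    · exact ⟨d, hd, le_rfl, by simp [h0]⟩
    · exact ⟨x % d, h0, (Nat.mod_lt _ hd).le, Nat.mod_mod _ _⟩
  have hj : ∀ j : Fin d, (j : ℕ) * d + e ≤ d ^ 2 := fun j => by
    have := Nat.mul_le_mul_right d (show (j : ℕ) + 1 ≤ d from j.2)
    rw [add_mul, one_mul, ← pow_two] at this
    omega
  conv_lhs => rw [← Fintype.card_fin d, ← Finset.card_univ]
  refine Finset.card_le_card_of_injOn
    (fun j : Fin d => ⟨((x : ℕ) - 1) / d ^ 2 * d ^ 2 + (j * d + e), by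
      have := hj j; omega⟩) ?_ ?_
  · intro j _
    refine Finset.mem_coe.2 (Finset.mem_filter.2 ⟨Finset.mem_univ _, ?_⟩)
    simp only [blueClass, Prod.mk.injEq]
    have := hj j
    constructor
    · have h1 : ((x : ℕ) - 1) / d ^ 2 * d ^ 2 + (j * d + e) + (d ^ 2 - 1)
          = d ^ 2 * (((x : ℕ) - 1) / d ^ 2 + 1) + (j * d + e - 1) := by
        rw [mul_add, mul_one, mul_comm (d ^ 2) (((x : ℕ) - 1) / d ^ 2)]
        omega
      have h2 : (x : ℕ) + (d ^ 2 - 1) = (x - 1) + d ^ 2 := by omega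
      have h4 : ((j : ℕ) * d + e - 1) / d ^ 2 = 0 := Nat.div_eq_of_lt (by omega)
      rw [h1, h2, Nat.mul_add_div hd2, h4, Nat.add_div_right _ hd2]
    · rw [pow_two, ← mul_assoc, ← add_assoc, ← add_mul, Nat.mul_add_mod', hemod]
  · intro i _ j _ hij
    simp only [Fin.mk.injEq] at hij
    ext
    exact Nat.eq_of_mul_eq_mul_right hd (by omega)

theorem eq_of_redClass_eq_of_blueClass_eq {x y : Fin (d ^ 3 + 1)}
    (hr : redClass d x = redClass d y) (hb : blueClass d x = blueClass d y) : x = y := by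
  simp only [redClass, blueClass, Prod.mk.injEq] at hr hb
  ext
  rw [← Nat.div_add_mod (x : ℕ) d, hr, hb.2, Nat.div_add_mod]

theorem lt_add_of_div_eq {a b m : ℕ} (hm : 0 < m) (h : a / m = b / m) : b < a + m := by
  have h1 := Nat.div_add_mod a m
  have h2 := Nat.div_add_mod b m
  have h3 := Nat.mod_lt b hm
  rw [h] at h1
  omega

/-- The graph on `0, …, d ^ 3` joining vertices in the same red or in the same blue class. -/
def transmitterGraph (d : ℕ) : SimpleGraph (Fin (d ^ 3 + 1)) :=
  fiberGraph (redClass d) ⊔ fiberGraph (blueClass d)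

theorem lt_add_of_transmitterGraph_adj (hd : 0 < d) {x y : Fin (d ^ 3 + 1)}
    (h : (transmitterGraph d).Adj x y) : (y : ℕ) < x + d ^ 2 := by
  have hd2 : 0 < d ^ 2 := by positivity
  rcases h with h | h
  · exact (lt_add_of_div_eq hd h.2).trans_le
      (Nat.add_le_add_left (Nat.le_self_pow two_ne_zero d) _)
  · have := lt_add_of_div_eq hd2 (Prod.mk.inj h.2).1
    omega

theorem le_add_of_walk (hd : 0 < d) {R : SimpleGraph (Fin (d ^ 3 + 1))}
    (hR : R ≤ transmitterGraph d) {x y : Fin (d ^ 3 + 1)} (p : R.Walk x y) :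
    (y : ℕ) ≤ x + p.length * d ^ 2 := by
  induction p with
  | nil => simp
  | cons h p ih =>
    have := lt_add_of_transmitterGraph_adj hd (hR h)
    rw [SimpleGraph.Walk.length_cons, add_mul]
    omega

theorem not_reachable_zero_last (hd : 0 < d) {R : SimpleGraph (Fin (d ^ 3 + 1))}
    (hR : R ≤ transmitterGraph d) (hP : ¬ HasNPath R (d + 1)) :
    ¬ R.Reachable 0 (Fin.last (d ^ 3)) := by
  intro h
  obtain ⟨p, hp⟩ := h.exists_isPath
  have h1 := length_le_of_not_hasNPath hP _ p.isChain_adj_support hp.support_nodup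
  rw [SimpleGraph.Walk.length_support] at h1
  have h2 := le_add_of_walk hd hR p
  have h3 := Nat.mul_le_mul_right (d ^ 2) h1
  have hd2 : 0 < d ^ 2 := by positivity
  rw [add_mul] at h3
  simp only [Fin.val_last, Fin.val_zero, pow_succ' d 2] at h2
  omega

theorem two_mul_le_degIn (hd : 0 < d) {x : Fin (d ^ 3 + 1)} (h0 : x ≠ 0)
    (h1 : x ≠ Fin.last (d ^ 3)) :
    2 * (d - 1) ≤ degIn (transmitterGraph d) Finset.univ x := by
  classical
  set A := Finset.univ.filter fun y => redClass d y = redClass d x with hA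
  set B := Finset.univ.filter fun y => blueClass d y = blueClass d x with hB
  have hAc := le_card_redClass hd (x := x) (Fin.val_lt_last h1)
  have hBc := le_card_blueClass hd (x := x) (Nat.pos_of_ne_zero (Fin.val_ne_zero_iff.2 h0))
  rw [← hA] at hAc
  rw [← hB] at hBc
  have hdisj : Disjoint (A.erase x) (B.erase x) := by
    rw [Finset.disjoint_left]
    intro y hy hy'
    simp only [hA, hB, Finset.mem_erase, Finset.mem_filter] at hy hy'
    exact hy.1 (eq_of_redClass_eq_of_blueClass_eq hy.2.2 hy'.2.2)
  have hxA : x ∈ A := by simp [hA]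
  have hxB : x ∈ B := by simp [hB]
  calc 2 * (d - 1) ≤ (A.erase x ∪ B.erase x).card := by
        rw [Finset.card_union_of_disjoint hdisj, Finset.card_erase_of_mem hxA,
          Finset.card_erase_of_mem hxB]
        omega
    _ ≤ _ := Finset.card_le_card fun y hy => by
        simp only [hA, hB, Finset.mem_union, Finset.mem_erase, Finset.mem_filter] at hy
        refine Finset.mem_filter.2 ⟨Finset.mem_univ _, ?_⟩
        rcases hy with hy | hy
        · exact Or.inl ⟨hy.1.symm, hy.2.2.symm⟩
        · exact Or.inr ⟨hy.1.symm, hy.2.2.symm⟩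

theorem degIn_zero_le (hd : 0 < d) : degIn (transmitterGraph d) Finset.univ 0 ≤ d - 1 := by
  classical
  have h := card_redClass_le hd 0
  set A := Finset.univ.filter fun y => redClass d y = redClass d 0 with hA
  have h0 : 0 ∈ A := by simp [hA]
  have hd2 : 0 < d ^ 2 := by positivity
  calc degIn (transmitterGraph d) Finset.univ 0 ≤ (A.erase 0).card :=
        Finset.card_le_card fun y hy => by
          rcases (Finset.mem_filter.1 hy).2 with hy | hy
          · simp [hA, hy.1.symm, hy.2]
          · have := lt_add_of_div_eq hd2 (Prod.mk.inj hy.2).1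
            have h0' := (Prod.mk.inj hy.2).1
            rw [Fin.val_zero, zero_add, Nat.div_eq_of_lt (by omega), eq_comm,
              Nat.div_eq_zero_iff_lt hd2] at h0'
            exact absurd (Fin.ext (by rw [Fin.val_zero]; omega)) hy.1
    _ ≤ d - 1 := by
        rw [Finset.card_erase_of_mem h0]
        omega

theorem degIn_zero_pos (hd : 2 ≤ d) : 0 < degIn (transmitterGraph d) Finset.univ 0 := by
  have h : 0 < d ^ 3 := by positivity
  refine degIn_pos_iff.2 ⟨⟨1, by omega⟩, Finset.mem_univ _, Or.inl ⟨?_, ?_⟩⟩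
  · simp [Fin.ext_iff]
  · simp [redClass, Nat.div_eq_of_lt hd]

theorem isGood_transmitterGraph (hd : 0 < d) : IsGood (transmitterGraph d) (d + 1) (d + 1) := by
  refine ⟨fiberGraph (redClass d), le_sup_left,
    not_hasNPath_of_length_le (length_le_of_isChain_fiberGraph (card_redClass_le hd)),
    not_hasNPath_of_length_le fun l hc =>
      length_le_of_isChain_fiberGraph (card_blueClass_le hd) l (hc.imp fun x y h => ?_)⟩
  exact h.1.resolve_left h.2

theorem degIn_zero_eq_zero_or_clique {D : ℕ} {R : SimpleGraph (Fin ((D + 1) ^ 3 + 1))}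
    (hR : GoodColoring (transmitterGraph (D + 1)) R (D + 2) (D + 2)) :
    (degIn R Finset.univ 0 = 0 ∨ ∃ K, 0 ∈ K ∧ R.IsNClique (D + 1) K) ∧
    (degIn (transmitterGraph (D + 1) \ R) Finset.univ 0 = 0 ∨
      ∃ K, 0 ∈ K ∧ (transmitterGraph (D + 1) \ R).IsNClique (D + 1) K) := by
  classical
  set G := transmitterGraph (D + 1) with hG
  obtain ⟨hRG, hred, hblue⟩ := hR
  set U : Finset (Fin ((D + 1) ^ 3 + 1)) := {0, Fin.last _} with hU
  have key : ∀ S ≤ G, ¬ HasNPath S (D + 2) →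
      ∑ z ∈ Finset.univ \ U, degIn S Finset.univ z ≤ D * (Finset.univ \ U).card ∧
      (∑ z ∈ Finset.univ \ U, degIn S Finset.univ z = D * (Finset.univ \ U).card →
        ∀ u ∈ U, u ∈ Finset.univ → degIn S Finset.univ u = 0 ∨
          ∃ K ⊆ Finset.univ, u ∈ K ∧ S.IsNClique (D + 1) K) := fun S hS hP => by
    have hnr := not_reachable_zero_last D.succ_pos hS hP
    suffices h : AvgDegLE S D Finset.univ U by
      unfold AvgDegLE at h
      convert h
    refine avgDegLE (length_le_of_not_hasNPath hP) _ _ fun u hu w hw huw => ?_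
    simp only [hU, Finset.mem_insert, Finset.mem_singleton] at hu hw
    rcases hu with rfl | rfl <;> rcases hw with rfl | rfl
    exacts [rfl, absurd huw hnr, absurd huw.symm hnr, rfl]
  obtain ⟨hr1, hr2⟩ := key R hRG hred
  obtain ⟨hb1, hb2⟩ := key (G \ R) sdiff_le hblue
  have hsum : ∑ z ∈ Finset.univ \ U, degIn R Finset.univ z
      + ∑ z ∈ Finset.univ \ U, degIn (G \ R) Finset.univ z
      = ∑ z ∈ Finset.univ \ U, degIn G Finset.univ z := by
    rw [← Finset.sum_add_distrib]
    exact Finset.sum_congr rfl fun z _ => degIn_sdiff_add hRG _ _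
  have hge : (Finset.univ \ U).card * (2 * D) ≤
      ∑ z ∈ Finset.univ \ U, degIn G Finset.univ z := by
    rw [← smul_eq_mul]
    refine Finset.card_nsmul_le_sum _ _ _ fun z hz => ?_
    simp only [hU, Finset.mem_sdiff, Finset.mem_univ, true_and, Finset.mem_insert,
      Finset.mem_singleton, not_or] at hz
    exact two_mul_le_degIn D.succ_pos hz.1 hz.2
  have hcomm : (Finset.univ \ U).card * (2 * D) = 2 * (D * (Finset.univ \ U).card) := by ring
  have h0 : (0 : Fin ((D + 1) ^ 3 + 1)) ∈ U := by simp [hU]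
  refine ⟨(hr2 (by omega) 0 h0 (Finset.mem_univ _)).imp_right ?_,
    (hb2 (by omega) 0 h0 (Finset.mem_univ _)).imp_right ?_⟩
  all_goals
    rintro ⟨K, -, hK⟩
    exact ⟨K, hK⟩

theorem le_degIn_of_isNClique {V : Type*} {R : SimpleGraph V} {s K : Finset V} {n : ℕ} {x : V}
    (hK : R.IsNClique n K) (hs : K ⊆ s) (hx : x ∈ K) : n - 1 ≤ degIn R s x := by
  classical
  rw [← hK.2, ← Finset.card_erase_of_mem hx]
  refine Finset.card_le_card fun z hz => ?_
  rw [Finset.mem_erase] at hz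
  exact Finset.mem_filter.2 ⟨hs hz.2, hK.1 hx hz.2 hz.1.symm⟩

theorem not_adj_of_degIn_univ_eq_zero {V : Type*} [Fintype V] {R : SimpleGraph V} {x : V}
    (h : degIn R Finset.univ x = 0) (y : V) : ¬ R.Adj x y := fun hxy =>
  (degIn_pos_iff.2 ⟨y, Finset.mem_univ _, hxy⟩).ne' h

end Construction

/-- for every k ≥ 3 there exists a (k, k−1)-transmitter. -/
theorem stmt4 (k : ℕ) (hk : 3 ≤ k) :
    ∃ (n : ℕ) (G : SimpleGraph (Fin n)) (v : Fin n),
      IsGood G k k ∧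
      ∀ R : SimpleGraph (Fin n), GoodColoring G R k k →
        (StrictEndpoint R v (k - 1) ∧ ∀ u, ¬ (G \ R).Adj v u) ∨
        (StrictEndpoint (G \ R) v (k - 1) ∧ ∀ u, ¬ R.Adj v u) := by
  obtain ⟨D, rfl⟩ : ∃ D, k = D + 2 := ⟨k - 2, by omega⟩
  refine ⟨(D + 1) ^ 3 + 1, transmitterGraph (D + 1), 0, isGood_transmitterGraph D.succ_pos,
    fun R hR => ?_⟩
  have hle := degIn_zero_le (d := D + 1) D.succ_pos
  have hpos := degIn_zero_pos (d := D + 1) (by omega)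
  have hadd := degIn_sdiff_add hR.1 Finset.univ 0
  obtain ⟨hr, hb⟩ := degIn_zero_eq_zero_or_clique hR
  rcases hr with hr | ⟨K, h0K, hK⟩
  · obtain ⟨K, h0K, hK⟩ := hb.resolve_left (by omega)
    exact Or.inr ⟨strictEndpoint_of_isNClique hR.2.2 h0K hK, not_adj_of_degIn_univ_eq_zero hr⟩
  · have := le_degIn_of_isNClique hK (Finset.subset_univ K) h0K
    exact Or.inl ⟨strictEndpoint_of_isNClique hR.2.1 h0K hK,
      not_adj_of_degIn_univ_eq_zero (by omega)⟩
end
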